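/- Suppose the structure on ℝ is d-minimal. Then every D^p submanifold of ℝⁿ is definably C^p diffeomorphic to a closed D^p submanifold of ℝ^{n+1}. -/

import Mathlib

open FirstOrder Set Filter Topology
open scoped Classical

noncomputable section

namespace DMinPaper

variable (L : FirstOrder.Language) [L.Structure ℝ]

/-- A subset of `ℝ^α` is definable (with parameters from `ℝ`) in the structure `L`. -/
def IsDef {α : Type} (s : Set (α → ℝ)) : Prop :=
  (Set.univ : Set ℝ).Definable L s

/-- Definability of an `ℝ`-valued function on a subset `M ⊆ ℝ^α`, via its graph. -/
def IsDefFunOn {α : Type} (M : Set (α → ℝ)) (f : (α → ℝ) → ℝ) : Prop :=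
  IsDef L {z : (α ⊕ Unit) → ℝ |
    (fun i => z (Sum.inl i)) ∈ M ∧ z (Sum.inr ()) = f (fun i => z (Sum.inl i))}

/-- Definability of a map `M → ℝ^β` on a subset `M ⊆ ℝ^α`, via its graph. -/
def IsDefMapOn {α β : Type} (M : Set (α → ℝ)) (f : (α → ℝ) → (β → ℝ)) : Prop :=
  IsDef L {z : (α ⊕ β) → ℝ |
    (fun i => z (Sum.inl i)) ∈ M ∧ (fun j => z (Sum.inr j)) = f (fun i => z (Sum.inl i))}

/-- Definability of an `ℝ`-valued function on a subset of a product `ℝ^α × ℝ^β`. -/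
def IsDefFun2On {α β : Type} (S : Set ((α → ℝ) × (β → ℝ)))
    (f : (α → ℝ) × (β → ℝ) → ℝ) : Prop :=
  IsDef L {z : ((α ⊕ β) ⊕ Unit) → ℝ |
    ((fun i => z (Sum.inl (Sum.inl i)), fun j => z (Sum.inl (Sum.inr j))) ∈ S) ∧
    z (Sum.inr ()) = f (fun i => z (Sum.inl (Sum.inl i)), fun j => z (Sum.inl (Sum.inr j)))}

/-- Definability of a map into `ℝ^γ` on a subset of a product `ℝ^α × ℝ^β`. -/
def IsDefMap2On {α β γ : Type} (S : Set ((α → ℝ) × (β → ℝ)))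
    (f : (α → ℝ) × (β → ℝ) → (γ → ℝ)) : Prop :=
  IsDef L {z : ((α ⊕ β) ⊕ γ) → ℝ |
    ((fun i => z (Sum.inl (Sum.inl i)), fun j => z (Sum.inl (Sum.inr j))) ∈ S) ∧
    (fun l => z (Sum.inr l)) = f (fun i => z (Sum.inl (Sum.inl i)), fun j => z (Sum.inl (Sum.inr j)))}

/-- Definability of a function `ℝ → ℝ`, via its graph. -/
def IsDefFunR (f : ℝ → ℝ) : Prop :=
  IsDef L {z : Fin 2 → ℝ | z 1 = f (z 0)}

/-- The structure expands the ordered field of real numbers: the order, addition and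
multiplication are definable. -/
def ExpandsOrderedField : Prop :=
  IsDef L {x : Fin 2 → ℝ | x 0 < x 1} ∧
  IsDef L {x : Fin 3 → ℝ | x 2 = x 0 + x 1} ∧
  IsDef L {x : Fin 3 → ℝ | x 2 = x 0 * x 1}

/-- A discrete subset of `ℝ`. -/
def IsDiscreteSet (D : Set ℝ) : Prop :=
  ∀ x ∈ D, ∃ U : Set ℝ, IsOpen U ∧ U ∩ D = {x}

/-- d-minimality: the structure expands the ordered field of reals, and in every definable
family of subsets of `ℝ` each fiber is the union of an open set and `N` discrete sets, where
`N` does not depend on the parameter. -/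
def DMinimal : Prop :=
  ExpandsOrderedField L ∧
  ∀ (k : ℕ) (S : Set ((Fin k ⊕ Unit) → ℝ)), IsDef L S →
    ∃ N : ℕ, ∀ a : Fin k → ℝ,
      ∃ (U : Set ℝ) (D : Fin N → Set ℝ),
        IsOpen U ∧ (∀ i, IsDiscreteSet (D i)) ∧
        {t : ℝ | Sum.elim a (fun _ => t) ∈ S} = U ∪ ⋃ i, D i

variable {E F : Type} [NormedAddCommGroup E] [NormedSpace ℝ E]
  [NormedAddCommGroup F] [NormedSpace ℝ F]

/-- `f` is of class `C^p` on `M` (as a function on the submanifold `M`): near each point of `M`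
it coincides on `M` with a `C^p` function defined on an ambient open set. -/
def CpOn (p : ℕ) (f : E → F) (M : Set E) : Prop :=
  ∀ x ∈ M, ∃ (U : Set E) (g : E → F),
    IsOpen U ∧ x ∈ U ∧ ContDiffOn ℝ p g U ∧ Set.EqOn f g (M ∩ U)

/-- The tangent vectors to `M` at `x`: velocities of differentiable curves through `x`
staying in `M`. -/
def TangentVecs (M : Set E) (x : E) : Set E :=
  {v | ∃ γ : ℝ → E, γ 0 = x ∧ (∀ᶠ t in 𝓝 (0:ℝ), γ t ∈ M) ∧ HasDerivAt γ v 0}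

/-- The differential of `f : M → N` at `x` is surjective onto the tangent space of `N`
at `f x`. -/
def SubmersionAtOn (f : E → F) (M : Set E) (N : Set F) (x : E) : Prop :=
  ∀ w ∈ TangentVecs N (f x), ∃ (γ : ℝ → E) (v : E),
    γ 0 = x ∧ (∀ᶠ t in 𝓝 (0:ℝ), γ t ∈ M) ∧ HasDerivAt γ v 0 ∧
    HasDerivAt (fun t => f (γ t)) w 0

/-- `x` is a critical point of `f : M → ℝ`: the differential of `f` at `x` vanishes on all
tangent vectors of `M` at `x`. -/
def IsCritPtOn (f : E → ℝ) (M : Set E) (x : E) : Prop :=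
  x ∈ M ∧ ∀ (γ : ℝ → E) (v : E), γ 0 = x → (∀ᶠ t in 𝓝 (0:ℝ), γ t ∈ M) →
    HasDerivAt γ v 0 → HasDerivAt (fun t => f (γ t)) 0 0

/-- `x` is a nondegenerate critical point of `f : M → ℝ` on the `d`-dimensional submanifold
`M`: in a local `C²` parametrization `ψ` of `M` at `x`, the Hessian of `f ∘ ψ` is a
nondegenerate bilinear form. -/
def IsNondegCritPtOn (f : E → ℝ) (M : Set E) (d : ℕ) (x : E) : Prop :=
  IsCritPtOn f M x ∧
  ∃ (W : Set (Fin d → ℝ)) (ψ : (Fin d → ℝ) → E) (w0 : Fin d → ℝ),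
    IsOpen W ∧ w0 ∈ W ∧ ContDiffOn ℝ 2 ψ W ∧ ψ w0 = x ∧ Set.MapsTo ψ W M ∧
    Function.Injective (fun u => fderiv ℝ ψ w0 u) ∧
    ∀ v : Fin d → ℝ, v ≠ 0 → ∃ w : Fin d → ℝ,
      iteratedFDeriv ℝ 2 (fun z => f (ψ z)) w0 ![v, w] ≠ 0

/-- `f` is a Morse function on the `d`-dimensional submanifold `M`: all critical points are
nondegenerate and distinct critical points have distinct critical values. -/
def IsMorseOn (f : E → ℝ) (M : Set E) (d : ℕ) : Prop :=
  (∀ x, IsCritPtOn f M x → IsNondegCritPtOn f M d x) ∧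
  ∀ x y, IsCritPtOn f M x → IsCritPtOn f M y → x ≠ y → f x ≠ f y

/-- `M ⊆ ℝⁿ` is a definable `C^p` submanifold of dimension `d`: `M` is definable and every
point of `M` has a definable `C^p` chart of `ℝⁿ` flattening `M` onto `ℝ^d × {0}`. -/
def IsDpSubmanifold (p : ℕ) {n : ℕ} (d : ℕ) (M : Set (Fin n → ℝ)) : Prop :=
  IsDef L M ∧ d ≤ n ∧
  ∀ x ∈ M, ∃ (U V : Set (Fin n → ℝ)) (φ ψ : (Fin n → ℝ) → (Fin n → ℝ)),
    IsOpen U ∧ x ∈ U ∧ IsOpen V ∧ (0 : Fin n → ℝ) ∈ V ∧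
    IsDef L U ∧ IsDef L V ∧ IsDefMapOn L U φ ∧ IsDefMapOn L V ψ ∧
    ContDiffOn ℝ p φ U ∧ ContDiffOn ℝ p ψ V ∧
    Set.MapsTo φ U V ∧ Set.MapsTo ψ V U ∧
    (∀ y ∈ U, ψ (φ y) = y) ∧ (∀ y ∈ V, φ (ψ y) = y) ∧
    φ x = 0 ∧ φ '' (M ∩ U) = V ∩ {y | ∀ i : Fin n, d ≤ (i : ℕ) → y i = 0}

/-- The definable set `X ⊆ ℝⁿ` has dimension at least `d`: some projection of `X` onto `d`
of the coordinates has nonempty interior. -/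
def hasDimGE {n : ℕ} (X : Set (Fin n → ℝ)) (d : ℕ) : Prop :=
  ∃ ι : Fin d → Fin n, StrictMono ι ∧ (interior ((fun x => fun i => x (ι i)) '' X)).Nonempty

/-- The dimension of `X ⊆ ℝⁿ`: the largest `d` such that some coordinate projection of `X`
onto `ℝ^d` has nonempty interior; `⊥` (i.e. `-∞`) for the empty set. -/
noncomputable def dimDef {n : ℕ} (X : Set (Fin n → ℝ)) : WithBot ℕ :=
  if X.Nonempty then ((sSup {d : ℕ | hasDimGE X d} : ℕ) : WithBot ℕ) else ⊥

/-- The coordinate projection `ℝⁿ → ℝ^d` determined by `ι`. -/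
def projc {n d : ℕ} (ι : Fin d → Fin n) (x : Fin n → ℝ) : Fin d → ℝ := fun i => x (ι i)

/-- An open box in `ℝⁿ`: a product of `n` nonempty open intervals. -/
def IsOpenBox {n : ℕ} (U : Set (Fin n → ℝ)) : Prop :=
  ∃ a b : Fin n → ℝ, (∀ i, a i < b i) ∧ U = Set.univ.pi fun i => Set.Ioo (a i) (b i)

/-- `M` is locally, at `x`, the image of a definable `C^p` section `τ` of the coordinate
projection `projc ι`. -/
def MultiGraphPtAt (p : ℕ) {n d : ℕ} (ι : Fin d → Fin n) (M : Set (Fin n → ℝ))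
    (x : Fin n → ℝ) : Prop :=
  ∃ U : Set (Fin n → ℝ), IsOpenBox U ∧ x ∈ U ∧
    ∃ τ : (Fin d → ℝ) → (Fin n → ℝ),
      IsDefMapOn L (projc ι '' U) τ ∧ ContDiffOn ℝ p τ (projc ι '' U) ∧
      M ∩ U = τ '' (projc ι '' U) ∧ ∀ z ∈ projc ι '' U, projc ι (τ z) = z

/-- A `D^p` multi-valued graph with respect to the coordinate projection `projc ι`. -/
def IsMultiGraph (p : ℕ) {n d : ℕ} (ι : Fin d → Fin n) (M : Set (Fin n → ℝ)) : Prop :=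
  IsDpSubmanifold L p d M ∧ ∀ x ∈ M, MultiGraphPtAt L p ι M x

/-- The gradient vector `(∂g/∂x₁, …, ∂g/∂x_d)` of `g : ℝ^d → ℝ` at `z`. -/
noncomputable def gradVec {d : ℕ} (g : (Fin d → ℝ) → ℝ) (z : Fin d → ℝ) : Fin d → ℝ :=
  fun i => fderiv ℝ g z (Pi.single i 1)

/-- The Hessian matrix `(∂²g/∂x_i∂x_j)` of `g : ℝ^d → ℝ` at `z`. -/
noncomputable def hessMat {d : ℕ} (g : (Fin d → ℝ) → ℝ) (z : Fin d → ℝ) :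
    Matrix (Fin d) (Fin d) ℝ :=
  Matrix.of fun i j => fderiv ℝ (fun w => fderiv ℝ g w (Pi.single j 1)) z (Pi.single i 1)

/-- The derivative of `f : M → ℝ` at `x` along the vector field `D`: the common value of
`d_x g (D x)` over all local `C¹` extensions `g` of `f` (and `0` if there is no such common
value). -/
noncomputable def vderiv (M : Set E) (D : E → E) (f : E → ℝ) (x : E) : ℝ :=
  if h : ∃ w : ℝ, ∀ (U : Set E) (g : E → ℝ), IsOpen U → x ∈ U → ContDiffOn ℝ 1 g U →
      Set.EqOn f g (M ∩ U) → fderiv ℝ g x (D x) = w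
  then h.choose else 0

/-- Iterated derivative `D_{α₁} ⋯ D_{α_m} f` of `f : M → ℝ` along a finite family of vector
fields, indexed by a list `α`. -/
noncomputable def vderivIter {k : ℕ} (M : Set E) (D : Fin k → E → E) :
    List (Fin k) → (E → ℝ) → E → ℝ
  | [], f => f
  | i :: l, f => vderiv M (D i) (vderivIter M D l f)

/-- spaces isometric to a finite power of the reals -/
class DS (Γ : Type) [PseudoMetricSpace Γ] where
  I : Type
  fin : Fintype I
  e : Γ ≃ᵢ (I → ℝ)

attribute [instance] DS.fin

instance instDSReal : DS ℝ where
  I := Unit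
  fin := inferInstance
  e := { toFun := fun x _ => x
         invFun := fun w => w ()
         left_inv := fun _ => rfl
         right_inv := fun _ => rfl
         isometry_toFun := by
          apply Isometry.of_dist_eq
          intro x y
          simp }

instance instDSPi {β : Type} [Fintype β] : DS (β → ℝ) where
  I := β
  fin := inferInstance
  e := IsometryEquiv.refl _

instance instDSProd {Γ Δ : Type} [PseudoMetricSpace Γ] [PseudoMetricSpace Δ] [a : DS Γ] [b : DS Δ] :
    DS (Γ × Δ) where
  I := a.I ⊕ b.I
  fin := inferInstance
  e := { toFun := fun x => Sum.elim (a.e x.1) (b.e x.2)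
         invFun := fun w => (a.e.symm (fun i => w (Sum.inl i)), b.e.symm (fun i => w (Sum.inr i)))
         left_inv := fun x => by simp
         right_inv := fun w => by
          funext i
          rcases i with i | i <;> simp
         isometry_toFun := by
          apply Isometry.of_dist_eq
          intro x y
          rw [Prod.dist_eq, ← a.e.dist_eq x.1, ← b.e.dist_eq x.2]
          apply le_antisymm
          · refine (dist_pi_le_iff (by positivity)).2 ?_
            rintro (i | i)
            · exact le_trans (dist_le_pi_dist (a.e x.1) (a.e y.1) i) (le_max_left _ _)
            · exact le_trans (dist_le_pi_dist (b.e x.2) (b.e y.2) i) (le_max_right _ _)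
          · apply max_le
            · refine (dist_pi_le_iff (by positivity)).2 fun i => ?_
              exact dist_le_pi_dist (Sum.elim (a.e x.1) (b.e x.2)) (Sum.elim (a.e y.1) (b.e y.2)) (Sum.inl i)
            · refine (dist_pi_le_iff (by positivity)).2 fun i => ?_
              exact dist_le_pi_dist (Sum.elim (a.e x.1) (b.e x.2)) (Sum.elim (a.e y.1) (b.e y.2)) (Sum.inr i) }

section layer
variable {L}
variable {Γ Δ Θ : Type} [PseudoMetricSpace Γ] [PseudoMetricSpace Δ] [PseudoMetricSpace Θ]
  [DS Γ] [DS Δ] [DS Θ]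

/-- definable predicate -/
def DP (L : FirstOrder.Language) [L.Structure ℝ] (P : Γ → Prop) : Prop :=
  IsDef L {w : DS.I Γ → ℝ | P (DS.e.symm w)}

/-- definable function -/
@[fun_prop]
def DF (L : FirstOrder.Language) [L.Structure ℝ] (f : Γ → Δ) : Prop :=
  DP L (fun p : Γ × Δ => p.2 = f p.1)

variable {L : FirstOrder.Language} [L.Structure ℝ]

theorem DP.and {P Q : Γ → Prop} (hP : DP L P) (hQ : DP L Q) : DP L (fun z => P z ∧ Q z) :=
  Set.Definable.inter hP hQ

theorem DP.or {P Q : Γ → Prop} (hP : DP L P) (hQ : DP L Q) : DP L (fun z => P z ∨ Q z) :=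
  Set.Definable.union hP hQ

theorem DP.not {P : Γ → Prop} (hP : DP L P) : DP L (fun z => ¬ P z) :=
  Set.Definable.compl hP

theorem DP.imp {P Q : Γ → Prop} (hP : DP L P) (hQ : DP L Q) : DP L (fun z => P z → Q z) := by
  have := hP.not.or hQ
  simpa only [imp_iff_not_or] using this

theorem DP.congr {P Q : Γ → Prop} (hP : DP L P) (h : ∀ z, Q z ↔ P z) : DP L Q := by
  have : Q = P := funext fun z => propext (h z)
  rwa [this]

theorem DP.ex {P : Γ → Δ → Prop} (h : DP L (fun p : Γ × Δ => P p.1 p.2)) :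
    DP L (fun z => ∃ t, P z t) := by
  have := Set.Definable.image_comp h (Sum.inl : DS.I Γ → DS.I Γ ⊕ DS.I Δ)
  unfold DP IsDef
  convert this using 1
  ext w
  constructor
  · rintro ⟨t, ht⟩
    refine ⟨Sum.elim w (DS.e t), ?_, rfl⟩
    change P (DS.e.symm w) (DS.e.symm (DS.e t))
    simpa using ht
  · rintro ⟨v, hv, rfl⟩
    exact ⟨_, hv⟩

theorem DP.all {P : Γ → Δ → Prop} (h : DP L (fun p : Γ × Δ => P p.1 p.2)) :
    DP L (fun z => ∀ t, P z t) := by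
  have := (DP.ex (P := fun z t => ¬ P z t) h.not).not
  simpa using this

theorem DP.reindex {Q : Δ → Prop} (hQ : DP L Q) (f : Γ → Δ) (σ : DS.I Δ → DS.I Γ)
    (hf : ∀ z i, DS.e (f z) i = DS.e z (σ i)) : DP L (fun z => Q (f z)) := by
  have := Set.Definable.preimage_comp σ hQ
  unfold DP IsDef
  convert this using 1
  ext w
  have : f (DS.e.symm w) = DS.e.symm (w ∘ σ) := by
    apply DS.e.injective
    funext i
    rw [hf]; simp
  simp [this]

theorem DP.eq_coord (i j : DS.I Γ) : DP L (fun z : Γ => DS.e z i = DS.e z j) := by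
  refine ⟨((Language.var i : (L[[(univ : Set ℝ)]]).Term (DS.I Γ)).equal (Language.var j)), ?_⟩
  ext w
  simp

theorem DP.coord_const (i : DS.I Γ) (c : ℝ) : DP L (fun z : Γ => DS.e z i = c) := by
  refine ⟨((Language.var i : (L[[(univ : Set ℝ)]]).Term (DS.I Γ)).equal
    (Language.Constants.term (L.con (⟨c, trivial⟩ : (univ : Set ℝ))))), ?_⟩
  ext w
  simp

theorem DP.fin {ι : Type} [Finite ι] {P : ι → Γ → Prop} (h : ∀ i, DP L (P i)) :
    DP L (fun z => ∀ i, P i z) := by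
  have := definable_iInter_of_finite h
  unfold DP IsDef
  convert this using 1
  ext w; simp

theorem DP.finE {ι : Type} [Finite ι] {P : ι → Γ → Prop} (h : ∀ i, DP L (P i)) :
    DP L (fun z => ∃ i, P i z) := by
  have := (DP.fin (fun i => (h i).not)).not
  simpa using this

theorem DP.diag : DP L (fun z : Γ × Γ => z.2 = z.1) := by
  refine (DP.fin (ι := DS.I Γ) (P := fun i (z : Γ × Γ) => DS.e z (Sum.inr i) = DS.e z (Sum.inl i))
    fun i => DP.eq_coord _ _).congr ?_
  intro z
  rw [← (DS.e (Γ := Γ)).injective.eq_iff]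
  exact funext_iff

theorem DP.true : DP L (fun _ : Γ => True) := Set.definable_univ

theorem DP.constP (p : Prop) : DP L (fun _ : Γ => p) := by
  by_cases h : p
  · exact DP.true.congr (by simp [h])
  · exact DP.true.not.congr (by simp [h])

theorem DP.comp {Q : Δ → Prop} (hQ : DP L Q) {f : Γ → Δ} (hf : DF L f) :
    DP L (fun z => Q (f z)) := by
  have h1 : DP L (fun p : Γ × Δ => Q p.2) := hQ.reindex _ Sum.inr (fun z i => rfl)
  exact (DP.ex (P := fun z w => w = f z ∧ Q w) (DP.and hf h1)).congr (by simp)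

@[fun_prop]
theorem DF.id : DF L (fun z : Γ => z) := DP.diag

@[fun_prop]
theorem DF.const (c : Δ) : DF L (fun _ : Γ => c) := by
  refine (DP.fin (ι := DS.I Δ) (P := fun i (z : Γ × Δ) => DS.e z (Sum.inr i) = DS.e c i)
    fun i => DP.coord_const _ _).congr ?_
  intro z
  rw [← (DS.e (Γ := Δ)).injective.eq_iff]
  exact funext_iff

theorem DF.reindex (f : Γ → Δ) (σ : DS.I Δ → DS.I Γ)
    (hf : ∀ z i, DS.e (f z) i = DS.e z (σ i)) : DF L f := by
  refine (DP.reindex (Γ := Γ × Δ) (DP.diag (Γ := Δ)) (fun p => (f p.1, p.2))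
    (Sum.elim (fun i => Sum.inl (σ i)) Sum.inr) ?_)
  rintro z (i | i)
  · exact hf _ _
  · rfl

@[fun_prop]
theorem DF.fst : DF L (fun z : Γ × Δ => z.1) := DF.reindex _ Sum.inl (fun _ _ => rfl)

@[fun_prop]
theorem DF.snd : DF L (fun z : Γ × Δ => z.2) := DF.reindex _ Sum.inr (fun _ _ => rfl)

@[fun_prop]
theorem DF.comp {g : Δ → Θ} {f : Γ → Δ} (hg : DF L g) (hf : DF L f) : DF L (fun z => g (f z)) := by
  have h1 : DP L (fun p : (Γ × Θ) × Δ => p.2 = f p.1.1) :=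
    DP.reindex hf (fun p : (Γ × Θ) × Δ => (p.1.1, p.2)) (Sum.elim (fun i => Sum.inl (Sum.inl i)) Sum.inr)
     (by rintro z (i | i) <;> rfl)
  have h2 : DP L (fun p : (Γ × Θ) × Δ => p.1.2 = g p.2) :=
    DP.reindex hg (fun p : (Γ × Θ) × Δ => (p.2, p.1.2)) (Sum.elim Sum.inr (fun i => Sum.inl (Sum.inr i)))
     (by rintro z (i | i) <;> rfl)
  exact (DP.ex (P := fun (p : Γ × Θ) w => w = f p.1 ∧ p.2 = g w) (h1.and h2)).congr (by simp)

@[fun_prop]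
theorem DF.prodMk {f : Γ → Δ} {g : Γ → Θ} (hf : DF L f) (hg : DF L g) :
    DF L (fun z => (f z, g z)) := by
  have h1 : DP L (fun p : Γ × (Δ × Θ) => p.2.1 = f p.1) :=
    DP.reindex hf (fun p : Γ × (Δ × Θ) => (p.1, p.2.1)) (Sum.elim Sum.inl (fun i => Sum.inr (Sum.inl i)))
     (by rintro z (i | i) <;> rfl)
  have h2 : DP L (fun p : Γ × (Δ × Θ) => p.2.2 = g p.1) :=
    DP.reindex hg (fun p : Γ × (Δ × Θ) => (p.1, p.2.2)) (Sum.elim Sum.inl (fun i => Sum.inr (Sum.inr i)))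
     (by rintro z (i | i) <;> rfl)
  exact (h1.and h2).congr (fun z => Prod.ext_iff)

@[fun_prop]
theorem DF.apply {β : Type} [Fintype β] (i : β) : DF L (fun z : β → ℝ => z i) :=
  DF.reindex _ (fun _ => i) (fun _ _ => rfl)

@[fun_prop]
theorem DF.pi {β : Type} [Fintype β] {f : Γ → β → ℝ} (h : ∀ i, DF L (fun z => f z i)) :
    DF L f := by
  refine (DP.fin (ι := β) (P := fun i (z : Γ × (β → ℝ)) => z.2 i = f z.1 i) fun i => ?_).congr ?_
  · exact DP.comp (f := fun z : Γ × (β → ℝ) => (z.1, z.2 i)) (h i)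
      (DF.prodMk DF.fst (DF.comp (DF.apply i) DF.snd))
  · intro z
    exact funext_iff

theorem DP.eq {f g : Γ → Δ} (hf : DF L f) (hg : DF L g) : DP L (fun z => f z = g z) :=
  DP.comp (f := fun z => (g z, f z)) DP.diag (by fun_prop)

theorem DF.of_graph {f : Γ → Δ} {R : Γ → Δ → Prop} (hR : DP L (fun p : Γ × Δ => R p.1 p.2))
    (h : ∀ z w, w = f z ↔ R z w) : DF L f :=
  hR.congr fun p => h _ _

theorem DF.ite {P : Γ → Prop} {f g : Γ → Δ} (hP : DP L P) (hf : DF L f) (hg : DF L g) :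
    DF L (fun z => if P z then f z else g z) := by
  have hP' : DP L (fun p : Γ × Δ => P p.1) := hP.comp DF.fst
  refine DF.of_graph (R := fun z w => (P z ∧ w = f z) ∨ (¬ P z ∧ w = g z)) ?_ ?_
  · exact (hP'.and hf).or (hP'.not.and hg)
  · intro z w
    by_cases h : P z <;> simp [h]

variable [hE : Fact (ExpandsOrderedField L)]

theorem DP.lt {f g : Γ → ℝ} (hf : DF L f) (hg : DF L g) : DP L (fun z => f z < g z) := by
  have h : DP L (fun x : Fin 2 → ℝ => x 0 < x 1) := hE.out.1
  refine DP.comp (f := fun z => ![f z, g z]) h (DF.pi fun i => ?_)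
  fin_cases i <;> simpa

theorem DP.le {f g : Γ → ℝ} (hf : DF L f) (hg : DF L g) : DP L (fun z => f z ≤ g z) :=
  (DP.lt hg hf).not.congr (by simp)

@[fun_prop]
theorem DF.add {f g : Γ → ℝ} (hf : DF L f) (hg : DF L g) : DF L (fun z => f z + g z) := by
  have h : DP L (fun x : Fin 3 → ℝ => x 2 = x 0 + x 1) := hE.out.2.1
  refine DP.comp (f := fun z : Γ × ℝ => ![f z.1, g z.1, z.2]) h (DF.pi fun i => ?_)
  fin_cases i <;> simp <;> fun_prop

@[fun_prop]
theorem DF.mul {f g : Γ → ℝ} (hf : DF L f) (hg : DF L g) : DF L (fun z => f z * g z) := by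
  have h : DP L (fun x : Fin 3 → ℝ => x 2 = x 0 * x 1) := hE.out.2.2
  refine DP.comp (f := fun z : Γ × ℝ => ![f z.1, g z.1, z.2]) h (DF.pi fun i => ?_)
  fin_cases i <;> simp <;> fun_prop

@[fun_prop]
theorem DF.neg {f : Γ → ℝ} (hf : DF L f) : DF L (fun z => - f z) := by
  have : DF L (fun z => (-1) * f z) := by fun_prop
  simpa using this

@[fun_prop]
theorem DF.sub {f g : Γ → ℝ} (hf : DF L f) (hg : DF L g) : DF L (fun z => f z - g z) := by
  simp only [sub_eq_add_neg]; fun_prop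

@[fun_prop]
theorem DF.pow {f : Γ → ℝ} (hf : DF L f) (k : ℕ) : DF L (fun z => f z ^ k) := by
  induction k with
  | zero => simp; fun_prop
  | succ k ih => simp only [pow_succ]; fun_prop

@[fun_prop]
theorem DF.inv {f : Γ → ℝ} (hf : DF L f) : DF L (fun z => (f z)⁻¹) := by
  refine DF.of_graph (R := fun z w => (f z = 0 ∧ w = 0) ∨ (f z * w = 1)) ?_ ?_
  · exact ((DP.eq (by fun_prop) (by fun_prop)).and (DP.eq (by fun_prop) (by fun_prop))).or
      (DP.eq (by fun_prop) (by fun_prop))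
  · intro z w
    by_cases h : f z = 0
    · simp [h]
    · simp only [h, false_and, false_or]
      constructor
      · rintro rfl; field_simp
      · intro h'; field_simp; linarith

@[fun_prop]
theorem DF.div {f g : Γ → ℝ} (hf : DF L f) (hg : DF L g) : DF L (fun z => f z / g z) := by
  simp only [div_eq_mul_inv]; fun_prop

@[fun_prop]
theorem DF.sum {ι : Type} (s : Finset ι) {f : ι → Γ → ℝ} (hf : ∀ i, DF L (f i)) :
    DF L (fun z => ∑ i ∈ s, f i z) := by
  induction s using Finset.induction_on with
  | empty => simp; fun_prop
  | insert a s ha ih => simp only [Finset.sum_insert ha]; exact (hf a).add ih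

@[fun_prop]
theorem DF.max {f g : Γ → ℝ} (hf : DF L f) (hg : DF L g) : DF L (fun z => max (f z) (g z)) := by
  have := DF.ite (DP.le hf hg) hg hf
  simpa only [max_def] using this

@[fun_prop]
theorem DF.coord (i : DS.I Γ) : DF L (fun z : Γ => DS.e z i) := DF.reindex _ (fun _ => i) (fun _ _ => rfl)

theorem DP.dist_lt {f g : Γ → Δ} {r : Γ → ℝ} (hf : DF L f) (hg : DF L g) (hr : DF L r) :
    DP L (fun z => dist (f z) (g z) < r z) := by
  refine ((DP.lt (DF.const 0) hr).and (DP.fin (ι := DS.I Δ) (P := fun i (z : Γ) =>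
     DS.e (f z) i - DS.e (g z) i < r z ∧ DS.e (g z) i - DS.e (f z) i < r z) fun i =>
     (DP.lt (DF.sub ((DF.coord i).comp hf) ((DF.coord i).comp hg)) hr).and
     (DP.lt (DF.sub ((DF.coord i).comp hg) ((DF.coord i).comp hf)) hr))).congr ?_
  intro z
  rw [← DS.e.dist_eq]
  constructor
  · intro h
    have h0 : 0 < r z := lt_of_le_of_lt dist_nonneg h
    refine ⟨h0, fun i => ?_⟩
    have := lt_of_le_of_lt (dist_le_pi_dist _ _ i) h
    rw [Real.dist_eq, abs_lt] at this
    constructor <;> linarith [this.1, this.2]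
  · rintro ⟨h0, h⟩
    refine (dist_pi_lt_iff h0).2 fun i => ?_
    rw [Real.dist_eq, abs_lt]
    constructor <;> linarith [(h i).1, (h i).2]

@[fun_prop]
theorem DF.distance {f g : Γ → Δ} (hf : DF L f) (hg : DF L g) : DF L (fun z => dist (f z) (g z)) := by
  refine DF.of_graph (R := fun z w => ∀ t : ℝ, dist (f z) (g z) < t ↔ w < t) ?_ ?_
  · refine DP.all ?_
    simp only [iff_def]
    have h1 : DP L (fun p : (Γ × ℝ) × ℝ => Dist.dist (f p.1.1) (g p.1.1) < p.2) :=
      DP.dist_lt (by fun_prop) (by fun_prop) (by fun_prop)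
    have h2 : DP L (fun p : (Γ × ℝ) × ℝ => p.1.2 < p.2) :=
      DP.lt (by fun_prop) (by fun_prop)
    exact (h1.imp h2).and (h2.imp h1)
  · intro z w
    constructor
    · rintro rfl t; rfl
    · intro h
      apply le_antisymm
      · exact le_of_forall_gt_imp_ge_of_dense fun t ht => ((h t).1 ht).le
      · exact le_of_forall_gt_imp_ge_of_dense fun t ht => ((h t).2 ht).le

theorem DP.ev {f : Γ → Δ} {P : Γ → Δ → Prop} (hf : DF L f) (hP : DP L (fun p : Γ × Δ => P p.1 p.2)) :
    DP L (fun z => ∀ᶠ y in 𝓝 (f z), P z y) := by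
  simp only [Metric.eventually_nhds_iff, gt_iff_lt]
  refine DP.ex ((DP.lt (by fun_prop) (by fun_prop)).and (DP.all ?_))
  refine DP.imp (DP.lt (by fun_prop) (by fun_prop)) ?_
  exact hP.comp (f := fun z : (Γ × ℝ) × Δ => (z.1.1, z.2)) (by fun_prop)

theorem DF.sInf {R : Γ → ℝ → Prop} (hR : DP L (fun p : Γ × ℝ => R p.1 p.2)) :
    DF L (fun z => sInf {c | R z c}) := by
  have hlb : DP L (fun p : Γ × ℝ => ∀ c, R p.1 c → p.2 ≤ c) := by
    refine DP.all (DP.imp ?_ (DP.le (by fun_prop) (by fun_prop)))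
    exact hR.comp (f := fun z : (Γ × ℝ) × ℝ => (z.1.1, z.2)) (by fun_prop)
  have hgood : DP L (fun p : Γ × ℝ => (∃ c, R p.1 c) ∧ ∃ b, ∀ c, R p.1 c → b ≤ c) := by
    refine DP.comp (f := Prod.fst) (Q := fun z => (∃ c, R z c) ∧ ∃ b, ∀ c, R z c → b ≤ c) ?_ DF.fst
    exact (DP.ex hR).and (DP.ex hlb)
  refine DF.of_graph (R := fun z w => (((∃ c, R z c) ∧ ∃ b, ∀ c, R z c → b ≤ c) ∧
      (∀ c, R z c → w ≤ c) ∧ ∀ b, (∀ c, R z c → b ≤ c) → b ≤ w) ∨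
      (¬ ((∃ c, R z c) ∧ ∃ b, ∀ c, R z c → b ≤ c) ∧ w = 0)) ?_ ?_
  · refine (hgood.and (hlb.and (DP.all (DP.imp ?_ (DP.le (by fun_prop) (by fun_prop)))))).or
      (hgood.not.and (DP.eq (by fun_prop) (by fun_prop)))
    exact hlb.comp (f := fun z : (Γ × ℝ) × ℝ => (z.1.1, z.2)) (by fun_prop)
  · intro z w
    by_cases h : (∃ c, R z c) ∧ ∃ b, ∀ c, R z c → b ≤ c
    · have hg : IsGLB {c | R z c} (InfSet.sInf {c | R z c}) := isGLB_csInf h.1 h.2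
      simp only [h, not_true, false_and, or_false, true_and]
      constructor
      · rintro rfl
        exact ⟨fun c hc => hg.1 hc, fun b hb => hg.2 hb⟩
      · intro hw
        exact IsGLB.unique (a := w) ⟨fun c hc => hw.1 c hc, fun b hb => hw.2 b hb⟩ hg
    · have : InfSet.sInf {c | R z c} = 0 := by
        rcases not_and_or.1 h with h1 | h1
        · have : {c | R z c} = ∅ := by
            ext c; simp; exact fun hc => h1 ⟨c, hc⟩
          rw [this, Real.sInf_empty]
        · exact Real.sInf_of_not_bddBelow h1
      simp only [h, this, not_false_eq_true, false_and, true_and, false_or]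
end layer

section gen
variable {L : FirstOrder.Language} [L.Structure ℝ]
variable {Γ Δ Θ : Type} [PseudoMetricSpace Γ] [PseudoMetricSpace Δ] [PseudoMetricSpace Θ]
  [DS Γ] [DS Δ] [DS Θ]

theorem DP.image (e : Γ ≃ Δ) (he : DF L e.symm) {P : Γ → Prop} (hP : DP L P) : DP L (fun w => P (e.symm w)) :=
  hP.comp he

/-- fibre set of a definable family of subsets of the line is open plus discrete, uniformly -/
theorem dmin_family (hL : DMinimal L) {d : ℕ} {P : (Fin d → ℝ) → ℝ → Prop}
    (hP : DP L (fun p : (Fin d → ℝ) × ℝ => P p.1 p.2)) :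
    ∃ N : ℕ, ∀ a, ∃ (U : Set ℝ) (D : Fin N → Set ℝ), IsOpen U ∧ (∀ i, IsDiscreteSet (D i)) ∧
      {t | P a t} = U ∪ ⋃ i, D i := by
  obtain ⟨N, hN⟩ := hL.2 d _ hP
  exact ⟨N, hN⟩

theorem IsDiscreteSet.nowhereDense {D : Set ℝ} (hD : IsDiscreteSet D) : IsNowhereDense D := by
  unfold IsNowhereDense
  by_contra h
  obtain ⟨x, hx⟩ := Set.nonempty_iff_ne_empty.2 h
  obtain ⟨y, hy1, hy2⟩ := mem_closure_iff.1 (interior_subset hx) _ isOpen_interior hx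
  obtain ⟨U, hU, hUD⟩ := hD y hy2
  have hyU : y ∈ U := by
    have : y ∈ U ∩ D := by rw [hUD]; rfl
    exact this.1
  have h1 : U ∩ interior (closure D) ⊆ {y} := by
    have : U ∩ closure D ⊆ closure (U ∩ D) := hU.inter_closure
    rw [hUD, closure_singleton] at this
    exact fun z hz => this ⟨hz.1, interior_subset hz.2⟩
  have h2 : IsOpen ({y} : Set ℝ) := by
    have : U ∩ interior (closure D) = {y} :=
      Subset.antisymm h1 (by rintro _ rfl; exact ⟨hyU, hy1⟩)
    rw [← this]; exact hU.inter isOpen_interior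
  exact not_isOpen_singleton y h2

variable [hE : Fact (ExpandsOrderedField L)]

/-- dichotomy -/
def Dich (L : FirstOrder.Language) [L.Structure ℝ] (Γ : Type) [PseudoMetricSpace Γ] [DS Γ] : Prop :=
  ∀ P : Γ → Prop, DP L P → ∀ᶠ y in residual Γ, P y → ∀ᶠ y' in 𝓝 y, P y'

theorem IsNowhereDense.ev {X : Type} [TopologicalSpace X] {s : Set X} (h : IsNowhereDense s) : ∀ᶠ y in residual X, y ∉ s := by
  have : IsMeagre s := h.isMeagre
  exact this

theorem Dich.of_nd (h : ∀ P : Γ → Prop, DP L P → interior {y | P y} = ∅ → IsNowhereDense {y | P y}) :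
    Dich L Γ := by
  intro P hP
  have h1 : DP L (fun y => P y ∧ ¬ ∀ᶠ y' in 𝓝 y, P y') :=
    hP.and (DP.ev (P := fun _ y => P y) DF.id (hP.comp DF.snd)).not
  have h2 := h _ h1 (by
    by_contra hne
    obtain ⟨x, hx⟩ := Set.nonempty_iff_ne_empty.2 hne
    have hx' := interior_subset hx
    apply hx'.2
    filter_upwards [isOpen_interior.mem_nhds hx] with y hy
    exact (interior_subset hy).1)
  filter_upwards [IsNowhereDense.ev h2] with y hy hPy
  by_contra h3
  exact hy ⟨hPy, h3⟩

theorem dich_real_nd (hL : DMinimal L) (P : ℝ → Prop) (hP : DP L P) (hi : interior {y | P y} = ∅) :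
    IsNowhereDense {y | P y} := by
  have hP' : DP L (fun p : (Fin 0 → ℝ) × ℝ => P p.2) := hP.comp DF.snd
  obtain ⟨N, hN⟩ := dmin_family (P := fun _ t => P t) hL hP'
  obtain ⟨U, D, hU, hD, h⟩ := hN 0
  have hU0 : U = ∅ := by
    apply Set.subset_empty_iff.1
    rw [← hi]
    exact interior_maximal (by rw [h]; exact subset_union_left) hU
  rw [h, hU0, empty_union]
  have : ∀ s : Finset (Fin N), IsNowhereDense (⋃ i ∈ s, D i) := by
    intro s
    induction s using Finset.induction_on with
    | empty => simp [IsNowhereDense]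
    | insert a s ha ih =>
      rw [Finset.set_biUnion_insert]
      unfold IsNowhereDense at *
      rw [closure_union]
      rw [interior_union_isClosed_of_interior_empty isClosed_closure ih]
      exact (hD a).nowhereDense
  simpa using this Finset.univ

theorem dich_real (hL : DMinimal L) : Dich L ℝ := Dich.of_nd (dich_real_nd hL)

theorem res_open_false {X : Type} [TopologicalSpace X] [BaireSpace X] {U : Set X} (hU : IsOpen U)
    {x : X} (hx : x ∈ U) {p : X → Prop} (h : ∀ᶠ y in residual X, p y) : ∃ y ∈ U, p y := by
  obtain ⟨y, hy1, hy2⟩ := (dense_of_mem_residual h).inter_open_nonempty U hU ⟨x, hx⟩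
  exact ⟨y, hy1, hy2⟩

theorem dich_prod (hL : DMinimal L) [BaireSpace Γ] (h : Dich L Γ) : Dich L (Γ × ℝ) := by
  apply Dich.of_nd
  intro P hP hi
  by_contra hnd
  obtain ⟨⟨b, t⟩, hbt⟩ := Set.nonempty_iff_ne_empty.2 hnd
  obtain ⟨B, I, hB, hbB, hI, htI, hBI⟩ :=
    mem_nhds_prod_iff'.1 (isOpen_interior.mem_nhds hbt)
  have hcl : B ×ˢ I ⊆ closure {y | P y} := hBI.trans interior_subset
  have h1 : ∀ᶠ y in residual Γ, ∀ q r : ℚ, (Ioo (q:ℝ) r ⊆ I) → (q:ℝ) < r → y ∈ B →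
      ∃ s ∈ Ioo (q:ℝ) r, P (y, s) := by
    rw [eventually_countable_forall]; intro q
    rw [eventually_countable_forall]; intro r
    have hd : DP L (fun y : Γ => ¬ ∃ s : ℝ, ((q:ℝ) < s ∧ s < r) ∧ P (y, s)) := by
      refine (DP.ex (((DP.lt (by fun_prop) (by fun_prop)).and (DP.lt (by fun_prop) (by fun_prop))).and ?_)).not
      exact hP
    filter_upwards [h _ hd] with y hy hI' hqr hyB
    by_contra hcon
    have h2 := hy hcon
    obtain ⟨V, hV, hVo, hyV⟩ := eventually_nhds_iff.1 (h2.and (hB.mem_nhds hyB))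
    have : (y, ((q:ℝ)+r)/2) ∈ closure {y | P y} := hcl ⟨hyB, hI' ⟨by linarith, by linarith⟩⟩
    obtain ⟨⟨y', s⟩, hm, hPm⟩ := mem_closure_iff.1 this (V ×ˢ Ioo (q:ℝ) r) (hVo.prod isOpen_Ioo)
      ⟨hyV, by linarith, by linarith⟩
    exact (hV y' hm.1).1 ⟨s, hm.2, hPm⟩
  have h2 : ∀ᶠ y in residual Γ, ∀ q r : ℚ, (q:ℝ) < r → ¬ Ioo (q:ℝ) r ⊆ {s | P (y, s)} := by
    rw [eventually_countable_forall]; intro q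
    rw [eventually_countable_forall]; intro r
    have hd : DP L (fun y : Γ => ∀ s : ℝ, ((q:ℝ) < s ∧ s < r) → P (y, s)) := by
      refine (DP.all (((DP.lt (by fun_prop) (by fun_prop)).and (DP.lt (by fun_prop) (by fun_prop))).imp ?_))
      exact hP
    filter_upwards [h _ hd] with y hy hqr hsub
    have h3 := hy (fun s hs => hsub hs)
    have : (y, ((q:ℝ)+r)/2) ∈ interior {y | P y} := by
      rw [mem_interior_iff_mem_nhds, mem_nhds_prod_iff]
      refine ⟨_, h3, Ioo (q:ℝ) r, Ioo_mem_nhds (by linarith) (by linarith), ?_⟩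
      rintro ⟨y', s⟩ ⟨h4, h5⟩
      exact h4 s h5
    rw [hi] at this
    exact this
  obtain ⟨y, hyB, hy1, hy2⟩ := res_open_false hB hbB (h1.and h2)
  have hPy : DP L (fun s => P (y, s)) := hP.comp (f := fun s : ℝ => (y, s)) (by fun_prop)
  have h3 : I ⊆ closure {s | P (y, s)} := by
    intro s hs
    rw [Metric.mem_closure_iff]
    intro ε hε
    obtain ⟨δ, hδ, hball⟩ := Metric.isOpen_iff.1 hI s hs
    obtain ⟨q, hq1, hq2⟩ := exists_rat_btwn (show s - min ε δ < s by have := lt_min hε hδ; linarith)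
    obtain ⟨r, hr1, hr2⟩ := exists_rat_btwn (show s < s + min ε δ by have := lt_min hε hδ; linarith)
    have m1 := min_le_left ε δ
    have m2 := min_le_right ε δ
    obtain ⟨u, hu, hPu⟩ := hy1 q r (fun v hv => hball (by
      rw [Metric.mem_ball, Real.dist_eq, abs_lt]; constructor <;> linarith [hv.1, hv.2]))
      (by linarith) hyB
    refine ⟨u, hPu, ?_⟩
    rw [Real.dist_eq, abs_lt]; constructor <;> linarith [hu.1, hu.2]
  have h4 : interior {s | P (y, s)} ≠ ∅ := by
    intro h5
    have := dich_real_nd hL _ hPy h5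
    have h6 : t ∈ interior (closure {s | P (y, s)}) := interior_maximal h3 hI htI
    rw [this] at h6
    exact h6
  obtain ⟨s, hs⟩ := Set.nonempty_iff_ne_empty.2 h4
  obtain ⟨δ, hδ, hball⟩ := Metric.isOpen_iff.1 isOpen_interior s hs
  obtain ⟨q, hq1, hq2⟩ := exists_rat_btwn (show s - δ < s by linarith)
  obtain ⟨r, hr1, hr2⟩ := exists_rat_btwn (show s < s + δ by linarith)
  refine hy2 q r (by linarith) fun v hv => interior_subset (hball ?_)
  rw [Metric.mem_ball, Real.dist_eq, abs_lt]; constructor <;> linarith [hv.1, hv.2]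

theorem Dich.transfer (h : Dich L Γ) (e : Γ ≃ₜ Δ) (he : DF L e) : Dich L Δ := by
  intro P hP
  have h1 := h (fun x => P (e x)) (hP.comp he)
  have h2 : ∀ᶠ y in residual Δ, P (e (e.symm y)) → ∀ᶠ y' in 𝓝 (e.symm y), P (e y') := by
    have := tendsto_residual_of_isOpenMap e.symm.continuous e.symm.isOpenMap
    exact this.eventually h1
  filter_upwards [h2] with y hy hPy
  rw [e.apply_symm_apply] at hy
  have := hy hPy
  have h3 := (e.symm.continuous.tendsto y).eventually this
  simpa using h3

theorem dich_pi (hL : DMinimal L) (d : ℕ) : Dich L (Fin d → ℝ) := by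
  induction d with
  | zero =>
    intro P hP
    refine Eventually.of_forall fun y hy => Eventually.of_forall fun y' => ?_
    rwa [Subsingleton.elim y' y]
  | succ d ih =>
    have := dich_prod hL ih
    let e : (Fin d → ℝ) × ℝ ≃ₜ (Fin (d + 1) → ℝ) :=
      { toFun := fun p => Fin.cons p.2 p.1
        invFun := fun w => (fun i => w i.succ, w 0)
        left_inv := fun p => by simp
        right_inv := fun w => by
          funext i
          refine Fin.cases ?_ (fun j => ?_) i <;> simp
        continuous_toFun := by
          refine continuous_pi fun i => ?_
          refine Fin.cases ?_ (fun j => ?_) i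
          · simp; fun_prop
          · simp; fun_prop
        continuous_invFun := by fun_prop }
    refine this.transfer e ?_
    refine DF.pi fun i => ?_
    refine Fin.cases ?_ (fun j => ?_) i
    · simp [e]; fun_prop
    · simp [e]; fun_prop

theorem gen_cont (h : Dich L Γ) {f : Γ → ℝ} (hf : DF L f) : ∀ᶠ y in residual Γ, ContinuousAt f y := by
  have h1 : ∀ᶠ y in residual Γ, ∀ q r : ℚ, ((q:ℝ) < f y ∧ f y < r) → ∀ᶠ y' in 𝓝 y, ((q:ℝ) < f y' ∧ f y' < r) := by
    rw [eventually_countable_forall]; intro q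
    rw [eventually_countable_forall]; intro r
    exact h _ ((DP.lt (by fun_prop) hf).and (DP.lt hf (by fun_prop)))
  filter_upwards [h1] with y hy
  unfold ContinuousAt
  rw [Metric.tendsto_nhds]
  intro ε hε
  obtain ⟨q, hq1, hq2⟩ := exists_rat_btwn (show f y - ε < f y by linarith)
  obtain ⟨r, hr1, hr2⟩ := exists_rat_btwn (show f y < f y + ε by linarith)
  filter_upwards [hy q r ⟨hq2, hr1⟩] with z hz
  rw [Real.dist_eq, abs_lt]; constructor <;> linarith [hz.1, hz.2]

theorem DP.contAt {F : Γ → Δ → ℝ} (hF : DF L (fun p : Γ × Δ => F p.1 p.2)) :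
    DP L (fun p : Γ × Δ => ContinuousAt (F p.1) p.2) := by
  simp only [ContinuousAt, Metric.tendsto_nhds, gt_iff_lt]
  refine DP.all (DP.imp (DP.lt (by fun_prop) (by fun_prop)) ?_)
  refine DP.ev (by fun_prop) (DP.lt (DF.distance ?_ ?_) (by fun_prop))
  · exact hF.comp (f := fun p : ((Γ × Δ) × ℝ) × Δ => (p.1.1.1, p.2)) (by fun_prop)
  · exact hF.comp (f := fun p : ((Γ × Δ) × ℝ) × Δ => (p.1.1.1, p.1.1.2)) (by fun_prop)
end gen

section oned
theorem const_of_locmax {g : ℝ → ℝ} {I : Set ℝ} (hI : IsOpen I) (hp : IsPreconnected I)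
    (hc : ∀ s ∈ I, ContinuousAt g s) (hm : ∀ s ∈ I, ∀ᶠ y in 𝓝 s, g y ≤ g s) :
    ∀ s ∈ I, ∀ t ∈ I, g s = g t := by
  have key : ∀ t ∈ I, ∀ s ∈ I, g s ≤ g t := by
    intro t ht
    have h1 : I ⊆ {s | s ∈ I ∧ g s ≤ g t} := by
      apply hp.subset_of_closure_inter_subset
      · rw [isOpen_iff_mem_nhds]
        rintro s ⟨hs, hst⟩
        filter_upwards [hI.mem_nhds hs, hm s hs] with y h1 h2
        exact ⟨h1, h2.trans hst⟩
      · exact ⟨t, ht, ht, le_rfl⟩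
      · rintro s ⟨hs, hsI⟩
        refine ⟨hsI, ?_⟩
        by_contra hlt
        have := (hc s hsI).eventually (lt_mem_nhds (not_le.1 hlt))
        obtain ⟨y, hy1, hy2⟩ := mem_closure_iff_nhds.1 hs _ this
        exact absurd hy2.2 (not_le.2 hy1)
    exact fun s hs => (h1 hs).2
  exact fun s hs t ht => le_antisymm (key t ht s hs) (key s hs t ht)

theorem diff_of_mono {g : ℝ → ℝ} {u v : ℝ} (huv : u < v) (h : MonotoneOn g (Icc u v)) :
    ∃ t ∈ Ioo u v, DifferentiableAt ℝ g t := by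
  have h1 := h.ae_differentiableWithinAt measurableSet_Icc
  have h2 : ∀ᵐ x ∂(MeasureTheory.volume.restrict (Ioo u v)), DifferentiableWithinAt ℝ g (Icc u v) x :=
    MeasureTheory.ae_restrict_of_ae_restrict_of_subset Ioo_subset_Icc_self h1
  have h3 : MeasureTheory.volume.restrict (Ioo u v) ≠ 0 := by
    rw [Ne, MeasureTheory.Measure.restrict_eq_zero, Real.volume_Ioo]
    simp [huv]
  haveI : (MeasureTheory.ae (MeasureTheory.volume.restrict (Ioo u v))).NeBot := MeasureTheory.ae_neBot.2 h3
  obtain ⟨x, hx1, hx2⟩ := (h2.and (MeasureTheory.ae_restrict_mem measurableSet_Ioo)).exists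
  exact ⟨x, hx2, hx1.differentiableAt (Icc_mem_nhds hx2.1 hx2.2)⟩

variable {L : FirstOrder.Language} [L.Structure ℝ] [hE : Fact (ExpandsOrderedField L)]

theorem diff1 (hL : DMinimal L) {g : ℝ → ℝ} (hg : DF L g) {U : Set ℝ} (hU : IsOpen U) {x : ℝ}
    (hx : x ∈ U) : ∃ t ∈ U, DifferentiableAt ℝ g t := by
  have hD := dich_real hL
  have hc0 : DP L (fun t : ℝ => ContinuousAt g t) :=
    (DP.contAt (F := fun _ : ℝ => g) (hg.comp DF.snd)).comp (f := fun t : ℝ => (t, t)) (by fun_prop)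
  have hmx : DP L (fun t : ℝ => ∀ᶠ y in 𝓝 t, g y ≤ g t) :=
    DP.ev DF.id (DP.le (by fun_prop) (by fun_prop))
  have hmn : DP L (fun t : ℝ => ∀ᶠ y in 𝓝 t, g t ≤ g y) :=
    DP.ev DF.id (DP.le (by fun_prop) (by fun_prop))
  obtain ⟨t, htU, h1, h2, h3, h4, h5, h6⟩ := res_open_false hU hx
    ((gen_cont hD hg).and ((hD _ hc0).and ((hD _ hmx).and ((hD _ hmx.not).and ((hD _ hmn).and (hD _ hmn.not))))))
  replace h2 := h2 h1
  have key : ∀ P : ℝ → Prop, (∀ᶠ y in 𝓝 t, P y) → ∃ u v, u < t ∧ t < v ∧ Icc u v ⊆ U ∧ ∀ y ∈ Icc u v, P y := by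
    intro P hP
    obtain ⟨δ, hδ, hb⟩ := Metric.mem_nhds_iff.1 (hP.and (hU.mem_nhds htU))
    have : ∀ y ∈ Icc (t - δ/2) (t + δ/2), P y ∧ y ∈ U := by
      intro y hy
      apply hb
      rw [Metric.mem_ball, Real.dist_eq, abs_lt]
      constructor <;> linarith [hy.1, hy.2]
    exact ⟨t - δ/2, t + δ/2, by linarith, by linarith, fun y hy => (this y hy).2, fun y hy => (this y hy).1⟩
  by_cases hA : ∀ᶠ y in 𝓝 t, g y ≤ g t
  · obtain ⟨u, v, hu, hv, hsub, hP⟩ := key _ ((h3 hA).and h2)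
    have := const_of_locmax (g := g) isOpen_Ioo (isPreconnected_Ioo (a := u) (b := v))
      (fun s hs => (hP s (Ioo_subset_Icc_self hs)).2) (fun s hs => (hP s (Ioo_subset_Icc_self hs)).1)
    refine ⟨t, htU, ?_⟩
    have h7 : g =ᶠ[𝓝 t] fun _ => g t := by
      filter_upwards [Ioo_mem_nhds hu hv] with y hy
      exact this y hy t ⟨hu, hv⟩
    exact (differentiableAt_const _).congr_of_eventuallyEq h7
  by_cases hB : ∀ᶠ y in 𝓝 t, g t ≤ g y
  · obtain ⟨u, v, hu, hv, hsub, hP⟩ := key _ ((h5 hB).and h2)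
    have := const_of_locmax (g := fun s => - g s) isOpen_Ioo (isPreconnected_Ioo (a := u) (b := v))
      (fun s hs => (hP s (Ioo_subset_Icc_self hs)).2.neg) (fun s hs => by
        simpa using (hP s (Ioo_subset_Icc_self hs)).1)
    refine ⟨t, htU, ?_⟩
    have h7 : g =ᶠ[𝓝 t] fun _ => g t := by
      filter_upwards [Ioo_mem_nhds hu hv] with y hy
      exact neg_injective (this y hy t ⟨hu, hv⟩)
    exact (differentiableAt_const _).congr_of_eventuallyEq h7
  obtain ⟨u, v, hu, hv, hsub, hP⟩ := key _ (((h4 hA).and (h6 hB)).and h2)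
  have huv : u < v := hu.trans hv
  have hcont : ContinuousOn g (Icc u v) := fun s hs => (hP s hs).2.continuousWithinAt
  have hinj' : ∀ a ∈ Icc u v, ∀ b ∈ Icc u v, a < b → g a ≠ g b := by
    intro a ha b hb hab heq
    obtain ⟨c, hc, hext⟩ := exists_isLocalExtr_Ioo hab
      (hcont.mono (Icc_subset_Icc ha.1 hb.2)) heq
    have hc' := hP c ⟨ha.1.trans hc.1.le, hc.2.le.trans hb.2⟩
    rcases hext with h | h
    · exact hc'.1.2 h
    · exact hc'.1.1 h
  have hinj : InjOn g (Icc u v) := by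
    intro a ha b hb heq
    by_contra hne
    rcases lt_or_gt_of_ne hne with h | h
    · exact hinj' a ha b hb h heq
    · exact hinj' b hb a ha h heq.symm
  rcases hcont.strictMonoOn_of_injOn_Icc' huv.le hinj with h | h
  · obtain ⟨s, hs, hd⟩ := diff_of_mono huv h.monotoneOn
    exact ⟨s, hsub (Ioo_subset_Icc_self hs), hd⟩
  · obtain ⟨s, hs, hd⟩ := diff_of_mono (g := fun s => - g s) huv h.antitoneOn.neg
    refine ⟨s, hsub (Ioo_subset_Icc_self hs), ?_⟩
    simpa using hd.neg
end oned

section partials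
variable {d : ℕ}

/-- partial derivative -/
def pd (i : Fin d) (f : (Fin d → ℝ) → ℝ) (y : Fin d → ℝ) : ℝ := lineDeriv ℝ f y (Pi.single i 1)

/-- existence of the partial derivative -/
def PD (i : Fin d) (f : (Fin d → ℝ) → ℝ) (y : Fin d → ℝ) : Prop :=
  LineDifferentiableAt ℝ f y (Pi.single i 1)

theorem hasDeriv_shift {f : (Fin d → ℝ) → ℝ} {i : Fin d} {y : Fin d → ℝ} {t : ℝ}
    (h : PD i f (y + t • Pi.single i (1:ℝ))) :
    HasDerivAt (fun s : ℝ => f (y + s • Pi.single i (1:ℝ))) (pd i f (y + t • Pi.single i (1:ℝ))) t := by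
  have h1 : HasDerivAt (fun s : ℝ => f ((y + t • Pi.single i (1:ℝ)) + s • Pi.single i (1:ℝ)))
      (pd i f (y + t • Pi.single i (1:ℝ))) (t - t) := by
    rw [sub_self]; exact h.hasLineDerivAt
  have h2 := h1.comp_sub_const t t
  refine h2.congr_of_eventuallyEq (Eventually.of_forall fun s => ?_)
  change f _ = f _
  congr 1
  rw [add_assoc, ← add_smul]; congr 2; ring

theorem mv_aux {f : (Fin d → ℝ) → ℝ} {y w : Fin d → ℝ} {a : Fin d} {δ c ε C : ℝ}
    (hb2 : ∀ ⦃z⦄, dist z y < δ → PD a f z ∧ |pd a f z - C| < ε)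
    (hnear : ∀ t ∈ uIcc 0 c, dist (w + t • Pi.single a (1:ℝ)) y < δ) :
    |f (w + c • Pi.single a (1:ℝ)) - C * c - f (w + (0:ℝ) • Pi.single a (1:ℝ))| ≤ ε * |c| := by
  have hder : ∀ t ∈ uIcc 0 c, HasDerivWithinAt (fun s : ℝ => f (w + s • Pi.single a (1:ℝ)) - C * s)
      (pd a f (w + t • Pi.single a (1:ℝ)) - C) (uIcc 0 c) t := by
    intro t ht
    have h5 := hasDeriv_shift (hb2 (hnear t ht)).1
    have h6 : HasDerivAt (fun s : ℝ => C * s) C t := by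
      simpa using (hasDerivAt_id t).const_mul C
    exact (h5.sub h6).hasDerivWithinAt
  have hbd : ∀ t ∈ uIcc 0 c, ‖pd a f (w + t • Pi.single a (1:ℝ)) - C‖ ≤ ε := by
    intro t ht
    rw [Real.norm_eq_abs]
    exact (hb2 (hnear t ht)).2.le
  have mv := Convex.norm_image_sub_le_of_norm_hasDerivWithin_le hder hbd
    (convex_uIcc _ _) left_mem_uIcc right_mem_uIcc
  rw [mul_zero, sub_zero, sub_zero, Real.norm_eq_abs, Real.norm_eq_abs] at mv
  exact mv

theorem hasFDerivAt_of_pd {f : (Fin d → ℝ) → ℝ} {y : Fin d → ℝ}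
    (h1 : ∀ᶠ y' in 𝓝 y, ∀ i, PD i f y') (h2 : ∀ i, ContinuousAt (pd i f) y) :
    HasFDerivAt f (∑ i, pd i f y • (ContinuousLinearMap.proj i : (Fin d → ℝ) →L[ℝ] ℝ)) y := by
  have key : ∀ s : Finset (Fin d), ∀ ε > 0, ∃ δ > 0, ∀ h : Fin d → ℝ, ‖h‖ < δ →
      |f (y + fun i => if i ∈ s then h i else 0) - f y - ∑ i ∈ s, pd i f y * h i| ≤ ε * ‖h‖ := by
    intro s
    induction s using Finset.induction_on with
    | empty =>
      intro ε hε
      refine ⟨1, one_pos, fun h _ => ?_⟩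
      have : (fun i : Fin d => if i ∈ (∅ : Finset (Fin d)) then h i else 0) = 0 := by
        funext i; simp
      rw [this]; simp; positivity
    | insert a s ha ih =>
      intro ε hε
      obtain ⟨δ1, hδ1, hb1⟩ := ih (ε/2) (by positivity)
      have h3 : ∀ᶠ y' in 𝓝 y, PD a f y' ∧ |pd a f y' - pd a f y| < ε/2 := by
        have := Metric.tendsto_nhds.1 (h2 a) (ε/2) (by positivity)
        filter_upwards [h1, this] with y' h4 h5
        exact ⟨h4 a, h5⟩
      obtain ⟨δ2, hδ2, hb2⟩ := Metric.eventually_nhds_iff.1 h3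
      refine ⟨min δ1 δ2, lt_min hδ1 hδ2, fun h hh => ?_⟩
      have hh1 := hb1 h (hh.trans_le (min_le_left _ _))
      set w : Fin d → ℝ := y + fun i => if i ∈ s then h i else 0 with hw
      have e1 : (y + fun i => if i ∈ insert a s then h i else 0) = w + h a • Pi.single a (1:ℝ) := by
        funext i
        by_cases hi : i = a
        · subst hi; simp [hw, ha]
        · simp [hw, hi]
      have e0 : w + (0:ℝ) • Pi.single a (1:ℝ) = w := by simp
      have hnear : ∀ t ∈ uIcc 0 (h a), dist (w + t • Pi.single a (1:ℝ)) y < δ2 := by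
        intro t ht
        rw [dist_eq_norm]
        have hn : |t| ≤ |h a| := by
          have := abs_sub_left_of_mem_uIcc ht
          simpa using this
        refine lt_of_le_of_lt ?_ (hh.trans_le (min_le_right _ _))
        refine (pi_norm_le_iff_of_nonneg (norm_nonneg _)).2 fun i => ?_
        by_cases hi : i = a
        · subst hi
          have : (w + t • (Pi.single i (1:ℝ) : Fin d → ℝ) - y) i = t := by simp [hw, ha]
          rw [this]
          exact hn.trans (norm_le_pi_norm h i)
        · have : (w + t • (Pi.single a (1:ℝ) : Fin d → ℝ) - y) i = if i ∈ s then h i else 0 := by simp [hw, hi]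
          rw [this]
          split_ifs
          · exact norm_le_pi_norm h i
          · simp
      have mv := mv_aux hb2 hnear
      rw [e0] at mv
      rw [e1, Finset.sum_insert ha]
      have hha : |h a| ≤ ‖h‖ := norm_le_pi_norm h a
      have : f (w + h a • Pi.single a 1) - f y - (pd a f y * h a + ∑ i ∈ s, pd i f y * h i)
        = (f (w + h a • Pi.single a 1) - pd a f y * h a - f w) + (f w - f y - ∑ i ∈ s, pd i f y * h i) := by ring
      rw [this]
      refine (abs_add_le _ _).trans ?_
      have : ε/2 * |h a| ≤ ε/2 * ‖h‖ := by gcongr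
      linarith
  rw [hasFDerivAt_iff_isLittleO_nhds_zero, Asymptotics.isLittleO_iff]
  intro ε hε
  obtain ⟨δ, hδ, hb⟩ := key Finset.univ ε hε
  filter_upwards [Metric.ball_mem_nhds 0 hδ] with h hh
  have := hb h (by simpa using hh)
  simpa [ContinuousLinearMap.sum_apply] using this

theorem cd_ev {E F : Type*} [NormedAddCommGroup E] [NormedSpace ℝ E]
    [NormedAddCommGroup F] [NormedSpace ℝ F] {p : ℕ} {f : E → F} {y : E} (h : ContDiffAt ℝ p f y) :
    ∀ᶠ y' in 𝓝 y, ContDiffAt ℝ p f y' := h.eventually (by simp)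

theorem cd_succ {p : ℕ} {f : (Fin d → ℝ) → ℝ} {y : Fin d → ℝ} :
    ContDiffAt ℝ ((p + 1 : ℕ)) f y ↔ (∀ᶠ y' in 𝓝 y, ∀ i, PD i f y') ∧ ∀ i, ContDiffAt ℝ p (pd i f) y := by
  push_cast
  rw [contDiffAt_succ_iff_hasFDerivAt]
  constructor
  · rintro ⟨f', ⟨u, hu, hf⟩, hf'⟩
    refine ⟨?_, fun i => ?_⟩
    · filter_upwards [hu] with y' hy' i
      exact ((hf y' hy').hasLineDerivAt _).lineDifferentiableAt
    · have h1 : ContDiffAt ℝ p (fun y' => f' y' (Pi.single i 1)) y := hf'.clm_apply contDiffAt_const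
      refine h1.congr_of_eventuallyEq ?_
      filter_upwards [hu] with y' hy'
      exact ((hf y' hy').hasLineDerivAt _).lineDeriv
  · rintro ⟨h1, h2⟩
    refine ⟨fun y' => ∑ i, pd i f y' • (ContinuousLinearMap.proj i : (Fin d → ℝ) →L[ℝ] ℝ), ?_, ?_⟩
    · have h3 : ∀ᶠ y' in 𝓝 y, ∀ i, ContinuousAt (pd i f) y' := by
        rw [eventually_all]
        intro i
        filter_upwards [cd_ev (h2 i)] with y' hy'
        exact hy'.continuousAt
      refine ⟨_, (eventually_eventually_nhds.2 h1).and h3, ?_⟩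
      rintro y' ⟨h4, h5⟩
      exact hasFDerivAt_of_pd h4 h5
    · exact ContDiffAt.sum fun i _ => (h2 i).smul contDiffAt_const

theorem cd_zero {f : (Fin d → ℝ) → ℝ} {y : Fin d → ℝ} :
    ContDiffAt ℝ (0:ℕ) f y ↔ ∀ᶠ y' in 𝓝 y, ContinuousAt f y' := by
  constructor
  · intro h
    filter_upwards [cd_ev h] with y' hy' using hy'.continuousAt
  · intro h
    push_cast
    exact contDiffAt_zero.2 ⟨_, h, fun z hz => ContinuousAt.continuousWithinAt hz⟩

variable {L : FirstOrder.Language} [L.Structure ℝ] [hE : Fact (ExpandsOrderedField L)]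
variable {Γ Δ Θ : Type} [PseudoMetricSpace Γ] [PseudoMetricSpace Δ] [PseudoMetricSpace Θ]
  [DS Γ] [DS Δ] [DS Θ]

@[fun_prop]
theorem DF.smul {β : Type} [Fintype β] {f : Γ → ℝ} {g : Γ → β → ℝ} (hf : DF L f) (hg : DF L g) :
    DF L (fun z => f z • g z) := by
  refine DF.pi fun i => ?_
  have : DF L (fun z => f z * g z i) := hf.mul ((DF.apply i).comp hg)
  exact this

@[fun_prop]
theorem DF.addv {β : Type} [Fintype β] {f : Γ → β → ℝ} {g : Γ → β → ℝ} (hf : DF L f) (hg : DF L g) :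
    DF L (fun z => f z + g z) := by
  refine DF.pi fun i => ?_
  have : DF L (fun z => f z i + g z i) := ((DF.apply i).comp hf).add ((DF.apply i).comp hg)
  exact this

theorem hasLine_iff {f : (Fin d → ℝ) → ℝ} {y v : Fin d → ℝ} {c : ℝ} :
    HasLineDerivAt ℝ f c y v ↔ ∀ ε : ℝ, 0 < ε → ∀ᶠ t in 𝓝 (0:ℝ),
      (dist (f (y + t • v) - f y) (t * c) < ε * dist t 0 ∨ t = 0) := by
  unfold HasLineDerivAt
  rw [hasDerivAt_iff_isLittleO_nhds_zero, Asymptotics.isLittleO_iff]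
  constructor
  · intro h ε hε
    filter_upwards [h (half_pos hε)] with t ht
    by_cases h0 : t = 0
    · exact Or.inr h0
    · left
      simp only [zero_add, zero_smul, add_zero, smul_eq_mul] at ht
      rw [dist_eq_norm, dist_zero_right]
      refine ht.trans_lt ?_
      have : 0 < ‖t‖ := norm_pos_iff.2 h0
      nlinarith
  · intro h ε hε
    filter_upwards [h ε hε] with t ht
    simp only [zero_add, zero_smul, add_zero, smul_eq_mul]
    rcases ht with ht | ht
    · rw [dist_eq_norm, dist_zero_right] at ht
      exact ht.le
    · simp [ht]

theorem DP.hasLine {F : Γ → (Fin d → ℝ) → ℝ} (hF : DF L (fun p : Γ × (Fin d → ℝ) => F p.1 p.2))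
    (v : Fin d → ℝ) : DP L (fun p : (Γ × (Fin d → ℝ)) × ℝ => HasLineDerivAt ℝ (F p.1.1) p.2 p.1.2 v) := by
  simp only [hasLine_iff]
  refine DP.all (DP.imp (DP.lt (by fun_prop) (by fun_prop)) ?_)
  refine DP.ev (by fun_prop) (DP.or (DP.lt ?_ (by fun_prop)) (DP.eq (by fun_prop) (by fun_prop)))
  refine DF.distance (DF.sub ?_ ?_) (by fun_prop)
  · exact hF.comp (f := fun p : (((Γ × (Fin d → ℝ)) × ℝ) × ℝ) × ℝ => (p.1.1.1.1, p.1.1.1.2 + p.2 • v)) (by fun_prop)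
  · exact hF.comp (f := fun p : (((Γ × (Fin d → ℝ)) × ℝ) × ℝ) × ℝ => (p.1.1.1.1, p.1.1.1.2)) (by fun_prop)

theorem DP.pd {F : Γ → (Fin d → ℝ) → ℝ} (hF : DF L (fun p : Γ × (Fin d → ℝ) => F p.1 p.2))
    (i : Fin d) : DP L (fun p : (Γ × (Fin d → ℝ)) => PD i (F p.1) p.2) := by
  refine (DP.ex (P := fun (p : Γ × (Fin d → ℝ)) w => HasLineDerivAt ℝ (F p.1) w p.2 (Pi.single i 1)) (DP.hasLine hF (Pi.single i 1))).congr fun z => ?_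
  constructor
  · intro h; exact ⟨_, h.hasLineDerivAt⟩
  · rintro ⟨c, hc⟩; exact hc.lineDifferentiableAt

theorem DF.pd {F : Γ → (Fin d → ℝ) → ℝ} (hF : DF L (fun p : Γ × (Fin d → ℝ) => F p.1 p.2))
    (i : Fin d) : DF L (fun p : (Γ × (Fin d → ℝ)) => pd i (F p.1) p.2) := by
  refine DF.of_graph (R := fun p w => HasLineDerivAt ℝ (F p.1) w p.2 (Pi.single i 1) ∨ (¬ PD i (F p.1) p.2 ∧ w = 0)) ?_ ?_
  · refine (DP.hasLine hF _).or (DP.and (DP.not ?_) (DP.eq (by fun_prop) (by fun_prop)))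
    exact (DP.pd hF i).comp DF.fst
  · intro z w
    by_cases h : PD i (F z.1) z.2
    · simp only [h, not_true, false_and, or_false]
      constructor
      · rintro rfl; exact h.hasLineDerivAt
      · intro h'; exact h'.lineDeriv.symm
    · have : DMinPaper.pd i (F z.1) z.2 = 0 := lineDeriv_zero_of_not_lineDifferentiableAt h
      rw [this]
      simp only [h, not_false_eq_true, true_and]
      constructor
      · exact Or.inr
      · rintro (h' | h')
        · exact absurd h'.lineDifferentiableAt h
        · exact h'

theorem DP.contDiffAt (p : ℕ) {F : Γ → (Fin d → ℝ) → ℝ} (hF : DF L (fun p : Γ × (Fin d → ℝ) => F p.1 p.2)) :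
    DP L (fun z : Γ × (Fin d → ℝ) => ContDiffAt ℝ p (F z.1) z.2) := by
  induction p generalizing F with
  | zero =>
    simp only [cd_zero]
    refine DP.ev (by fun_prop) ?_
    exact (DP.contAt hF).comp (f := fun p : (Γ × (Fin d → ℝ)) × (Fin d → ℝ) => (p.1.1, p.2)) (by fun_prop)
  | succ p ih =>
    simp only [cd_succ]
    refine DP.and (DP.ev (by fun_prop) (DP.fin fun i => ?_)) (DP.fin fun i => ih (F := fun z => DMinPaper.pd i (F z)) (DF.pd hF i))
    exact (DP.pd hF i).comp (f := fun p : (Γ × (Fin d → ℝ)) × (Fin d → ℝ) => (p.1.1, p.2)) (by fun_prop)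

theorem DP.contDiffAt' (p : ℕ) {f : (Fin d → ℝ) → ℝ} (hf : DF L f) :
    DP L (fun y : Fin d → ℝ => ContDiffAt ℝ p f y) :=
  (DP.contDiffAt p (F := fun _ : ℝ => f) (hf.comp DF.snd)).comp (f := fun y : Fin d → ℝ => ((0:ℝ), y)) (by fun_prop)

theorem gen_pd (hL : DMinimal L) {f : (Fin d → ℝ) → ℝ} (hf : DF L f) (i : Fin d) :
    ∀ᶠ y in residual (Fin d → ℝ), PD i f y := by
  have h1 : DP L (fun y => ¬ PD i f y) :=
    ((DP.pd (F := fun _ : ℝ => f) (hf.comp DF.snd) i).comp (f := fun y : Fin d → ℝ => ((0:ℝ), y)) (by fun_prop)).not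
  filter_upwards [dich_pi hL d _ h1] with y hy
  by_contra hcon
  have h2 := hy hcon
  have h3 : DF L (fun t : ℝ => f (y + t • Pi.single i (1:ℝ))) := hf.comp (by fun_prop)
  have h4 : Tendsto (fun t : ℝ => y + t • Pi.single i (1:ℝ)) (𝓝 0) (𝓝 y) := by
    have : Continuous (fun t : ℝ => y + t • Pi.single i (1:ℝ)) := by fun_prop
    simpa using this.tendsto 0
  obtain ⟨U, hU, hUo, h0⟩ := eventually_nhds_iff.1 (h4.eventually h2)
  obtain ⟨t, ht, hd⟩ := diff1 hL h3 hUo h0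
  apply hU t ht
  have hd1 : HasDerivAt (fun s : ℝ => f (y + s • Pi.single i (1:ℝ))) (deriv (fun s : ℝ => f (y + s • Pi.single i (1:ℝ))) t) (0 + t) := by
    rw [zero_add]; exact hd.hasDerivAt
  have hd2 := hd1.comp_add_const 0 t
  refine HasLineDerivAt.lineDifferentiableAt (f' := deriv (fun s : ℝ => f (y + s • Pi.single i (1:ℝ))) t) ?_
  refine hd2.congr_of_eventuallyEq (Eventually.of_forall fun s => ?_)
  change f _ = f _
  congr 1
  rw [add_assoc, ← add_smul]; congr 2; ring

/-- generic smoothness -/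
theorem gen_cd (hL : DMinimal L) (p : ℕ) {f : (Fin d → ℝ) → ℝ} (hf : DF L f) :
    ∀ᶠ y in residual (Fin d → ℝ), ContDiffAt ℝ p f y := by
  induction p generalizing f with
  | zero =>
    simp only [cd_zero]
    have hc0 : DP L (fun t => ContinuousAt f t) :=
      (DP.contAt (F := fun _ : ℝ => f) (hf.comp DF.snd)).comp (f := fun t : Fin d → ℝ => ((0:ℝ), t)) (by fun_prop)
    filter_upwards [gen_cont (dich_pi hL d) hf, dich_pi hL d _ hc0] with y h1 h2 using h2 h1
  | succ p ih =>
    simp only [cd_succ]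
    have h1 : DP L (fun y => ∀ i, PD i f y) := DP.fin fun i =>
      ((DP.pd (F := fun _ : ℝ => f) (hf.comp DF.snd) i).comp (f := fun y : Fin d → ℝ => ((0:ℝ), y)) (by fun_prop))
    have h2 : ∀ i, DF L (pd i f) := fun i =>
      ((DF.pd (F := fun _ : ℝ => f) (hf.comp DF.snd) i).comp (f := fun y : Fin d → ℝ => ((0:ℝ), y)) (by fun_prop))
    filter_upwards [dich_pi hL d _ h1, eventually_all.2 fun i => gen_pd hL hf i,
      eventually_all.2 fun i => ih (h2 i)] with y h3 h4 h5
    exact ⟨h3 h4, h5⟩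
end partials

section scat
/-- derived set inside `A` -/
def dr {X : Type} [TopologicalSpace X] (A : Set X) : Set X :=
  {x | x ∈ A ∧ ¬ ∀ᶠ y in 𝓝 x, y ∈ A → y = x}

variable {X : Type} [TopologicalSpace X]

theorem dr_mono {A B : Set X} (h : A ⊆ B) : dr A ⊆ dr B := by
  rintro x ⟨h1, h2⟩
  refine ⟨h h1, fun h3 => h2 ?_⟩
  filter_upwards [h3] with y hy hyA using hy (h hyA)

theorem dr_sub (A : Set X) : dr A ⊆ A := fun _ h => h.1

theorem drk_mono {A B : Set X} (h : A ⊆ B) (k : ℕ) : dr^[k] A ⊆ dr^[k] B := by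
  induction k with
  | zero => exact h
  | succ k ih => rw [Function.iterate_succ_apply', Function.iterate_succ_apply']; exact dr_mono ih

theorem drk_sub (A : Set X) (k : ℕ) : dr^[k] A ⊆ A := by
  induction k with
  | zero => exact subset_rfl
  | succ k ih => rw [Function.iterate_succ_apply']; exact (dr_sub _).trans ih

theorem drk_local {A W : Set X} (hW : IsOpen W) (k : ℕ) : dr^[k] A ∩ W ⊆ dr^[k] (A ∩ W) := by
  induction k with
  | zero => exact subset_rfl
  | succ k ih =>
    rw [Function.iterate_succ_apply', Function.iterate_succ_apply']
    rintro x ⟨⟨h1, h2⟩, hxW⟩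
    refine ⟨ih ⟨h1, hxW⟩, fun h3 => h2 ?_⟩
    filter_upwards [h3, hW.mem_nhds hxW] with y hy hyW hyA using hy (ih ⟨hyA, hyW⟩)

/-- rank bound for `M` discrete pieces -/
def rk : ℕ → ℕ
  | 0 => 0
  | M + 1 => rk M + (rk M + 1)

theorem drk_discrete [T1Space X] {κ : Type} (B : κ → Set X)
    (hB : ∀ c, ∀ x ∈ B c, ∃ U, IsOpen U ∧ x ∈ U ∧ ∀ y ∈ U, y ∈ B c → y = x) (s : Finset κ) :
    ∀ A : Set X, (∀ x ∈ A, ∃ c ∈ s, x ∈ B c) → dr^[rk s.card] A = ∅ := by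
  induction s using Finset.induction_on with
  | empty =>
    intro A hA
    ext x
    simp only [Finset.card_empty, rk, Function.iterate_zero, id_eq, mem_empty_iff_false, iff_false]
    intro hx
    obtain ⟨c, hc, _⟩ := hA x hx
    simp at hc
  | insert a s ha ih =>
    intro A hA
    rw [Finset.card_insert_of_notMem ha]
    rw [rk, Function.iterate_add_apply]
    apply ih
    intro x hx
    have hxA := drk_sub _ _ hx
    obtain ⟨c, hc, hxc⟩ := hA x hxA
    rcases Finset.mem_insert.1 hc with rfl | hc
    · exfalso
      obtain ⟨U, hU, hxU, huniq⟩ := hB c x hxc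
      rw [Function.iterate_succ_apply'] at hx
      apply hx.2
      filter_upwards [hU.mem_nhds hxU] with y hyU hyA
      by_contra hne
      have hW : IsOpen (U ∩ {x}ᶜ) := hU.inter isOpen_compl_singleton
      have h1 := drk_local hW (A := A) (rk s.card) ⟨hyA, hyU, hne⟩
      rw [ih (A ∩ (U ∩ {x}ᶜ))] at h1
      · exact h1
      · rintro z ⟨hzA, hzU, hzx⟩
        obtain ⟨c', hc', hzc⟩ := hA z hzA
        rcases Finset.mem_insert.1 hc' with rfl | hc'
        · exact absurd (huniq z hzU hzc) hzx
        · exact ⟨c', hc', hzc⟩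
    · exact ⟨c, hc, hxc⟩

theorem IsDiscreteSet.sep {D : Set ℝ} (hD : IsDiscreteSet D) {x : ℝ} (hx : x ∈ D) :
    ∃ U, IsOpen U ∧ x ∈ U ∧ ∀ y ∈ U, y ∈ D → y = x := by
  obtain ⟨U, hU, h⟩ := hD x hx
  refine ⟨U, hU, ?_, ?_⟩
  · have : x ∈ U ∩ D := by rw [h]; rfl
    exact this.1
  · intro y hy hyD
    have : y ∈ U ∩ D := ⟨hy, hyD⟩
    rw [h] at this; exact this

theorem drk_box {n : ℕ} (N : Fin n → ℕ) (A : Set (Fin n → ℝ))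
    (h : ∀ j, ∃ D : Fin (N j) → Set ℝ, (∀ i, IsDiscreteSet (D i)) ∧ ∀ x ∈ A, x j ∈ ⋃ i, D i) :
    dr^[rk (Fintype.card (∀ j, Fin (N j)))] A = ∅ := by
  choose D hD hA using h
  refine drk_discrete (κ := ∀ j, Fin (N j)) (fun c => {x | ∀ j, x j ∈ D j (c j)}) ?_ Finset.univ A ?_
  · intro c x hx
    have h1 : ∀ j, ∃ U, IsOpen U ∧ x j ∈ U ∧ ∀ y ∈ U, y ∈ D j (c j) → y = x j :=
      fun j => (hD j (c j)).sep (hx j)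
    choose U hU hxU hs using h1
    refine ⟨univ.pi U, isOpen_set_pi finite_univ fun j _ => hU j, fun j _ => hxU j, ?_⟩
    intro y hy hyB
    funext j
    exact hs j (y j) (hy j trivial) (hyB j)
  · intro x hx
    have h1 : ∀ j, ∃ i, x j ∈ D j i := fun j => mem_iUnion.1 (hA j x hx)
    choose c hc using h1
    exact ⟨c, Finset.mem_univ _, hc⟩
end scat

section dims
variable {L : FirstOrder.Language} [L.Structure ℝ] [hE : Fact (ExpandsOrderedField L)]
variable {Γ Δ Θ : Type} [PseudoMetricSpace Γ] [PseudoMetricSpace Δ] [PseudoMetricSpace Θ]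
  [DS Γ] [DS Δ] [DS Θ] {n d : ℕ}

/-- generic fibres of dimension `d` projections are empty -/
def dimLT (d : ℕ) (X : Set (Fin n → ℝ)) : Prop :=
  ∀ ι : Fin d → Fin n, Function.Injective ι → ∀ᶠ y in residual (Fin d → ℝ), ∀ x ∈ X, projc ι x ≠ y

/-- fibre -/
def fib (ι : Fin d → Fin n) (X : Set (Fin n → ℝ)) (y : Fin d → ℝ) : Set (Fin n → ℝ) :=
  {x | x ∈ X ∧ projc ι x = y}

@[fun_prop]
theorem DF.projc {f : Γ → Fin n → ℝ} (hf : DF L f) (ι : Fin d → Fin n) :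
    DF L (fun z => projc ι (f z)) :=
  DF.pi fun i => (DF.apply (ι i)).comp hf

@[fun_prop]
theorem continuous_projc (ι : Fin d → Fin n) : Continuous (projc ι) := by
  unfold DMinPaper.projc; fun_prop

theorem fiber_coord (hL : DMinimal L) {X : Set (Fin n → ℝ)} (hX : DP L (fun x => x ∈ X))
    (hd : dimLT (d + 1) X) {ι : Fin d → Fin n} (hι : Function.Injective ι) (j : Fin n) :
    ∃ N : ℕ, ∀ᶠ y in residual (Fin d → ℝ), ∃ D : Fin N → Set ℝ, (∀ i, IsDiscreteSet (D i)) ∧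
      ∀ x ∈ fib ι X y, x j ∈ ⋃ i, D i := by
  by_cases hj : j ∈ range ι
  · obtain ⟨i, rfl⟩ := hj
    refine ⟨1, Eventually.of_forall fun y => ⟨fun _ => {y i}, fun _ => ?_, ?_⟩⟩
    · rintro x hx
      refine ⟨univ, isOpen_univ, ?_⟩
      rw [univ_inter]
      rw [mem_singleton_iff.1 hx]
    · rintro x ⟨_, hx⟩
      simp [← hx, projc]
  have hP : DP L (fun p : (Fin d → ℝ) × ℝ => ∃ x, (x ∈ X ∧ projc ι x = p.1) ∧ x j = p.2) := by
    refine DP.ex (((hX.comp DF.snd).and (DP.eq ?_ ?_)).and (DP.eq ?_ ?_)) <;> fun_prop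
  obtain ⟨N, hN⟩ := dmin_family (P := fun y t => ∃ x, (x ∈ X ∧ projc ι x = y) ∧ x j = t) hL hP
  refine ⟨N, ?_⟩
  have hι' : Function.Injective (Fin.cons j ι : Fin (d+1) → Fin n) :=
    Fin.cons_injective_iff.2 ⟨hj, hι⟩
  have h1 := hd _ hι'
  have h2 : ∀ᶠ y in residual (Fin d → ℝ), ∀ q r : ℚ, (q:ℝ) < r →
      ¬ ∀ t : ℝ, ((q:ℝ) < t ∧ t < r) → ∃ x, (x ∈ X ∧ projc ι x = y) ∧ x j = t := by
    rw [eventually_countable_forall]; intro q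
    rw [eventually_countable_forall]; intro r
    have hd : DP L (fun y : Fin d → ℝ => ∀ t : ℝ, ((q:ℝ) < t ∧ t < r) → ∃ x, (x ∈ X ∧ projc ι x = y) ∧ x j = t) := by
      refine (DP.all (((DP.lt (by fun_prop) (by fun_prop)).and (DP.lt (by fun_prop) (by fun_prop))).imp ?_))
      exact hP
    filter_upwards [dich_pi hL d _ hd] with y hy hqr hsub
    obtain ⟨V, hV, hVo, hyV⟩ := eventually_nhds_iff.1 (hy hsub)
    have ho : IsOpen {w : Fin (d+1) → ℝ | w 0 ∈ Ioo (q:ℝ) r ∧ (fun i => w i.succ) ∈ V} := by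
      apply IsOpen.inter
      · exact isOpen_Ioo.preimage (by fun_prop)
      · exact hVo.preimage (f := fun w : Fin (d+1) → ℝ => (fun i => w i.succ)) (by fun_prop)
    obtain ⟨w, hw1, hw2⟩ := res_open_false ho (x := Fin.cons (((q:ℝ)+r)/2) y)
      (by constructor
          · simp only [Fin.cons_zero]; constructor <;> linarith
          · simpa using hyV) h1
    obtain ⟨x, ⟨hxX, hx1⟩, hx2⟩ := hV _ hw1.2 _ hw1.1
    refine hw2 x hxX ?_
    funext i
    refine Fin.cases ?_ (fun i => ?_) i
    · simpa [projc] using hx2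
    · have := congrFun hx1 i
      simpa [projc] using this
  filter_upwards [h2] with y hy
  obtain ⟨U, D, hU, hD, h⟩ := hN y
  have hU0 : U = ∅ := by
    by_contra hne
    obtain ⟨s, hs⟩ := Set.nonempty_iff_ne_empty.2 hne
    obtain ⟨δ, hδ, hball⟩ := Metric.isOpen_iff.1 hU s hs
    obtain ⟨q, hq1, hq2⟩ := exists_rat_btwn (show s - δ < s by linarith)
    obtain ⟨r, hr1, hr2⟩ := exists_rat_btwn (show s < s + δ by linarith)
    refine hy q r (by linarith) fun v hv => ?_
    have : v ∈ U ∪ ⋃ i, D i := Or.inl (hball (by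
      rw [Metric.mem_ball, Real.dist_eq, abs_lt]; constructor <;> linarith [hv.1, hv.2]))
    rw [← h] at this
    exact this
  refine ⟨D, hD, fun x hx => ?_⟩
  have : x j ∈ {t | ∃ x, (x ∈ X ∧ projc ι x = y) ∧ x j = t} := ⟨x, hx, rfl⟩
  rw [h, hU0, empty_union] at this
  exact this

theorem fiber_rank (hL : DMinimal L) {X : Set (Fin n → ℝ)} (hX : DP L (fun x => x ∈ X))
    (hd : dimLT (d + 1) X) {ι : Fin d → Fin n} (hι : Function.Injective ι) :
    ∃ k : ℕ, ∀ᶠ y in residual (Fin d → ℝ), dr^[k] (fib ι X y) = ∅ := by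
  choose N hN using fun j => fiber_coord hL hX hd hι j
  refine ⟨rk (Fintype.card (∀ j, Fin (N j))), ?_⟩
  filter_upwards [eventually_all.2 hN] with y hy
  exact drk_box N _ hy

/-- unique choice -/
def the {Γ Δ : Type} [Inhabited Δ] (R : Γ → Δ → Prop) (z : Γ) : Δ :=
  if h : ∃! w, R z w then h.choose else default

theorem the_spec {Γ Δ : Type} [Inhabited Δ] {R : Γ → Δ → Prop} {z : Γ} (h : ∃! w, R z w) :
    R z (the R z) := by
  unfold the; rw [dif_pos h]; exact h.choose_spec.1

theorem the_eq {Γ Δ : Type} [Inhabited Δ] {R : Γ → Δ → Prop} {z : Γ} (h : ∃! w, R z w) {w : Δ} (hw : R z w) :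
    the R z = w := h.unique (the_spec h) hw

theorem DP.exUnique {R : Γ → Δ → Prop} (hR : DP L (fun p : Γ × Δ => R p.1 p.2)) :
    DP L (fun z => ∃! w, R z w) := by
  unfold ExistsUnique
  refine DP.ex (hR.and (DP.all (DP.imp ?_ (DP.eq (by fun_prop) (by fun_prop)))))
  exact hR.comp (f := fun p : (Γ × Δ) × Δ => (p.1.1, p.2)) (by fun_prop)

theorem DF.the [Inhabited Δ] {R : Γ → Δ → Prop} (hR : DP L (fun p : Γ × Δ => R p.1 p.2)) :
    DF L (the R) := by
  have h1 : DP L (fun p : Γ × Δ => ∃! w, R p.1 w) := (DP.exUnique hR).comp DF.fst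
  refine DF.of_graph (R := fun z w => ((∃! w, R z w) ∧ R z w) ∨ (¬ (∃! w, R z w) ∧ w = default))
    ((h1.and hR).or (h1.not.and (DP.eq (by fun_prop) (by fun_prop)))) ?_
  intro z w
  by_cases h : ∃! w, R z w
  · simp only [h, true_and, not_true, false_and, or_false]
    constructor
    · rintro rfl; exact the_spec h
    · intro hw; exact (the_eq h hw).symm
  · simp only [h, false_and, not_false_eq_true, true_and, false_or]
    unfold DMinPaper.the; rw [dif_neg h]
end dims

section gstep
variable {L : FirstOrder.Language} [L.Structure ℝ] [hE : Fact (ExpandsOrderedField L)]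
variable {n d : ℕ}

/-- local graph structure -/
def MG (p : ℕ) (ι : Fin d → Fin n) (S : Set (Fin n → ℝ)) (h : (Fin n → ℝ) → ℝ) : Prop :=
  ∀ x ∈ S, ∃ (U : Set (Fin n → ℝ)) (σ : (Fin d → ℝ) → (Fin n → ℝ)), IsOpen U ∧ x ∈ U ∧
    ContDiffAt ℝ p σ (projc ι x) ∧ ContDiffAt ℝ p (fun y => h (σ y)) (projc ι x) ∧
    ∀ᶠ y in 𝓝 (projc ι x), (σ y ∈ S ∧ σ y ∈ U ∧ projc ι (σ y) = y) ∧
      ∀ x' ∈ S, x' ∈ U → projc ι x' = y → x' = σ y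

/-- relatively open -/
def ROpen {X : Type} [TopologicalSpace X] (S Y : Set X) : Prop :=
  S ⊆ Y ∧ ∀ x ∈ S, ∀ᶠ x' in 𝓝 x, x' ∈ Y → x' ∈ S

theorem gstep (hL : DMinimal L) (p : ℕ) {Y : Set (Fin n → ℝ)} (hY : DP L (fun x => x ∈ Y))
    {h : (Fin n → ℝ) → ℝ} (hh : DF L h) (ι : Fin d → Fin n) :
    ∃ S, DP L (fun x => x ∈ S) ∧ ROpen S Y ∧ MG p ι S h ∧
      ∀ᶠ y in residual (Fin d → ℝ), fib ι (Y \ S) y ⊆ dr (fib ι Y y) := by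
  let R : (((Fin n → ℝ) × ℝ) × (Fin d → ℝ)) → (Fin n → ℝ) → Prop :=
    fun z x => (x ∈ Y ∧ projc ι x = z.2) ∧ dist x z.1.1 < z.1.2
  have hR : DP L (fun q : (((Fin n → ℝ) × ℝ) × (Fin d → ℝ)) × (Fin n → ℝ) => R q.1 q.2) :=
    ((hY.comp DF.snd).and (DP.eq (by fun_prop) (by fun_prop))).and (DP.lt (by fun_prop) (by fun_prop))
  let F : ((Fin n → ℝ) × ℝ) → (Fin d → ℝ) → (Fin n → ℝ) := fun a y => the R (a, y)
  have hF : DF L (fun q : ((Fin n → ℝ) × ℝ) × (Fin d → ℝ) => F q.1 q.2) := DF.the hR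
  have hUq : DP L (fun q : ((Fin n → ℝ) × ℝ) × (Fin d → ℝ) => ∃! x, R q x) := DP.exUnique hR
  let G : ((Fin n → ℝ) × ℝ) → (Fin d → ℝ) → Prop := fun a y =>
    ((∀ᶠ y' in 𝓝 y, ∃! x, R (a, y') x) ∧ ∀ j, ContDiffAt ℝ p (fun y' => F a y' j) y) ∧
      ContDiffAt ℝ p (fun y' => h (F a y')) y
  have hG : DP L (fun q : ((Fin n → ℝ) × ℝ) × (Fin d → ℝ) => G q.1 q.2) := by
    refine DP.and (DP.and (DP.ev (by fun_prop) ?_) (DP.fin fun j => ?_)) ?_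
    · exact hUq.comp (f := fun q : (((Fin n → ℝ) × ℝ) × (Fin d → ℝ)) × (Fin d → ℝ) => (q.1.1, q.2)) (by fun_prop)
    · exact DP.contDiffAt p (F := fun a y' => F a y' j) ((DF.apply j).comp hF)
    · exact DP.contDiffAt p (F := fun a y' => h (F a y')) (hh.comp hF)
  have hGev : ∀ a y, G a y → ∀ᶠ y' in 𝓝 y, G a y' := by
    rintro a y ⟨⟨h1, h2⟩, h3⟩
    filter_upwards [eventually_eventually_nhds.2 h1, eventually_all.2 fun j => cd_ev (h2 j), cd_ev h3]
      with y' h4 h5 h6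
    exact ⟨⟨h4, h5⟩, h6⟩
  let S : Set (Fin n → ℝ) := {x | x ∈ Y ∧ ∃ a : (Fin n → ℝ) × ℝ, G a (projc ι x) ∧ dist x a.1 < a.2}
  refine ⟨S, ?_, ⟨fun x hx => hx.1, ?_⟩, ?_, ?_⟩
  · refine hY.and (DP.ex (DP.and ?_ (DP.lt (by fun_prop) (by fun_prop))))
    exact hG.comp (f := fun q : (Fin n → ℝ) × ((Fin n → ℝ) × ℝ) => (q.2, projc ι q.1)) (by fun_prop)
  · rintro x ⟨hxY, a, hGa, hda⟩
    have h1 : ∀ᶠ x' in 𝓝 x, G a (projc ι x') :=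
      ((continuous_projc ι).tendsto x).eventually (hGev _ _ hGa)
    have h2 : ∀ᶠ x' in 𝓝 x, dist x' a.1 < a.2 := Metric.isOpen_ball.mem_nhds hda
    filter_upwards [h1, h2] with x' h3 h4 h5
    exact ⟨h5, a, h3, h4⟩
  · rintro x ⟨hxY, a, hGa, hda⟩
    refine ⟨Metric.ball a.1 a.2, F a, Metric.isOpen_ball, hda, contDiffAt_pi.2 hGa.1.2, hGa.2, ?_⟩
    filter_upwards [hGev _ _ hGa] with y hy
    have hu := hy.1.1.self_of_nhds
    have hs : R (a, y) (F a y) := the_spec hu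
    refine ⟨⟨⟨hs.1.1, a, ?_, hs.2⟩, hs.2, hs.1.2⟩, ?_⟩
    · rw [hs.1.2]; exact hy
    · intro x' hx' hx'U hx'y
      exact (the_eq (R := R) hu (w := x') ⟨⟨hx'.1, hx'y⟩, hx'U⟩).symm
  · have key : ∀ᶠ y in residual (Fin d → ℝ), ∀ i m : ℕ,
        (∃! x, R ((TopologicalSpace.denseSeq (Fin n → ℝ) i, 1 / ((m:ℝ) + 1)), y) x) →
        G (TopologicalSpace.denseSeq (Fin n → ℝ) i, 1 / ((m:ℝ) + 1)) y := by
      rw [eventually_countable_forall]; intro i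
      rw [eventually_countable_forall]; intro m
      set a : (Fin n → ℝ) × ℝ := (TopologicalSpace.denseSeq (Fin n → ℝ) i, 1 / ((m:ℝ) + 1))
      have h1 := dich_pi hL d _ (hUq.comp (f := fun y : Fin d → ℝ => (a, y)) (by fun_prop))
      have h0 : DF L (fun y : Fin d → ℝ => F a y) :=
        hF.comp (f := fun y : Fin d → ℝ => (a, y)) (by fun_prop)
      have h2 : ∀ j, ∀ᶠ y in residual (Fin d → ℝ), ContDiffAt ℝ p (fun y' => F a y' j) y :=
        fun j => gen_cd hL p ((DF.apply j).comp h0)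
      have h3 := gen_cd hL p (hh.comp h0)
      filter_upwards [h1, eventually_all.2 h2, h3] with y h4 h5 h6 h7
      exact ⟨⟨h4 h7, h5⟩, h6⟩
    filter_upwards [key] with y hy
    rintro x ⟨⟨hxY, hxS⟩, hxy⟩
    refine ⟨⟨hxY, hxy⟩, fun hiso => hxS ?_⟩
    obtain ⟨δ, hδ, hb⟩ := Metric.eventually_nhds_iff.1 hiso
    obtain ⟨m, hm⟩ := exists_nat_one_div_lt (half_pos hδ)
    have hpos : (0:ℝ) < 1 / ((m:ℝ) + 1) := Nat.one_div_pos_of_nat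
    obtain ⟨_, hz, ⟨i, rfl⟩⟩ := (TopologicalSpace.denseRange_denseSeq (Fin n → ℝ)).exists_dist_lt x hpos |>.imp
      (fun i hi => (⟨hi, ⟨i, rfl⟩⟩ : _ ∧ ∃ j, j = i))
    refine ⟨hxY, (TopologicalSpace.denseSeq (Fin n → ℝ) i, 1 / ((m:ℝ) + 1)), ?_, hz⟩
    rw [hxy]
    apply hy
    refine ⟨x, ⟨⟨hxY, hxy⟩, hz⟩, ?_⟩
    rintro x' ⟨⟨h1, h2⟩, h3⟩
    refine hb ?_ ⟨h1, h2⟩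
    have := dist_triangle_right x' x (TopologicalSpace.denseSeq (Fin n → ℝ) i)
    simp only at h3
    linarith

theorem fib_mono {ι : Fin d → Fin n} {X Y : Set (Fin n → ℝ)} (h : X ⊆ Y) (y : Fin d → ℝ) :
    fib ι X y ⊆ fib ι Y y := fun _ hx => ⟨h hx.1, hx.2⟩

/-- stratification principle -/
theorem strat (hL : DMinimal L) (p : ℕ) {P : Set (Fin n → ℝ) → Prop}
    (step : ∀ X, DP L (fun x => x ∈ X) →
      (∀ Y ⊆ X, DP L (fun x => x ∈ Y) → Y.Nonempty → ∀ h, DF L h → ∃ (d : ℕ) (ι : Fin d → Fin n) (S : _),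
        DP L (fun x => x ∈ S) ∧ ROpen S Y ∧ MG p ι S h ∧ P (Y \ S)) → P X) :
    ∀ X, DP L (fun x => x ∈ X) → P X := by
  have main : ∀ d, ∀ X, DP L (fun x => x ∈ X) → dimLT d X → P X := by
    intro d
    induction d with
    | zero =>
      intro X hX hd
      apply step X hX
      rintro Y hYX - ⟨x, hx⟩
      exfalso
      obtain ⟨y, -, hy⟩ := res_open_false isOpen_univ (mem_univ 0) (hd Fin.elim0 (fun i => i.elim0))
      exact hy x (hYX hx) (Subsingleton.elim _ _)
    | succ d ihd =>
      have inner : ∀ m, ∀ X, DP L (fun x => x ∈ X) → ∀ k : (Fin d → Fin n) → ℕ,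
          (∀ ι, Function.Injective ι → ∀ᶠ y in residual (Fin d → ℝ), dr^[k ι] (fib ι X y) = ∅) →
          ∑ ι, k ι = m → P X := by
        intro m
        induction m using Nat.strong_induction_on with
        | _ m ih =>
        intro X hX k hk hm
        by_cases hex : ∃ ι, Function.Injective ι ∧ k ι ≠ 0
        · obtain ⟨ι, hι, hk0⟩ := hex
          apply step X hX
          intro Y hYX hY hne h hh
          obtain ⟨S, hS, hSY, hMG, hdr⟩ := gstep hL p hY hh ι
          refine ⟨d, ι, S, hS, hSY, hMG, ?_⟩
          refine ih (∑ ι', (Function.update k ι (k ι - 1)) ι') ?_ (Y \ S) (hY.and hS.not)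
            (Function.update k ι (k ι - 1)) ?_ rfl
          · rw [← hm]
            refine Finset.sum_lt_sum ?_ ⟨ι, Finset.mem_univ _, ?_⟩
            · intro ι' _
              by_cases h' : ι' = ι
              · subst h'; simp
              · simp [h']
            · simp; omega
          · intro ι' hι'
            by_cases h' : ι' = ι
            · subst h'
              filter_upwards [hdr, hk ι' hι'] with y h1 h2
              rw [Function.update_self]
              apply Set.subset_empty_iff.1
              rw [← h2]
              have : k ι' = (k ι' - 1) + 1 := by omega
              conv_rhs => rw [this]
              rw [Function.iterate_succ_apply]
              exact drk_mono (h1.trans (dr_mono (fib_mono hYX y))) _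
            · filter_upwards [hk ι' hι'] with y h2
              rw [Function.update_of_ne h']
              apply Set.subset_empty_iff.1
              rw [← h2]
              exact drk_mono (fib_mono (sdiff_subset.trans hYX) y) _
        · push Not at hex
          apply ihd X hX
          intro ι hι
          filter_upwards [hk ι hι] with y hy x hx hxy
          rw [hex ι hι] at hy
          have : x ∈ fib ι X y := ⟨hx, hxy⟩
          simp only [Function.iterate_zero, id_eq] at hy
          rw [hy] at this
          exact this
      intro X hX hd
      have h1 : ∀ ι : Fin d → Fin n, ∃ k : ℕ, Function.Injective ι →
          ∀ᶠ y in residual (Fin d → ℝ), dr^[k] (fib ι X y) = ∅ := by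
        intro ι
        by_cases hι : Function.Injective ι
        · obtain ⟨k, hk⟩ := fiber_rank hL hX hd hι
          exact ⟨k, fun _ => hk⟩
        · exact ⟨0, fun h => absurd h hι⟩
      choose k hk using h1
      exact inner _ X hX k hk rfl
  intro X hX
  refine main (n + 1) X hX ?_
  intro ι hι
  have := Fintype.card_le_of_injective ι hι
  simp at this
end gstep

section cutoff
theorem thp_hasDeriv (m : ℕ) (s : ℝ) :
    HasDerivAt (fun s : ℝ => (max s 0) ^ (m + 2)) ((m + 2 : ℝ) * (max s 0) ^ (m + 1)) s := by
  rcases lt_trichotomy s 0 with h | h | h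
  · have : (fun s : ℝ => (max s 0) ^ (m + 2)) =ᶠ[𝓝 s] fun _ => 0 := by
      filter_upwards [gt_mem_nhds h] with t ht
      rw [max_eq_right ht.le]; simp
    rw [max_eq_right h.le]
    simpa using (hasDerivAt_const s (0:ℝ)).congr_of_eventuallyEq this
  · subst h
    rw [max_self, hasDerivAt_iff_tendsto_slope]
    have h1 : Tendsto (fun t : ℝ => (max t 0) ^ (m + 1)) (𝓝[≠] 0) (𝓝 0) := by
      have : Continuous (fun t : ℝ => (max t 0) ^ (m + 1)) := by fun_prop
      have h2 := this.tendsto 0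
      simp only [max_self, ne_eq, Nat.add_eq_zero_iff, one_ne_zero, and_false, not_false_eq_true, zero_pow] at h2
      exact h2.mono_left nhdsWithin_le_nhds
    have h3 : ((m:ℝ) + 2) * 0 ^ (m + 1) = 0 := by simp
    rw [h3]
    refine h1.congr' ?_
    filter_upwards [self_mem_nhdsWithin] with t ht
    have ht' : t ≠ 0 := ht
    rw [slope_def_field]
    simp only [max_self, ne_eq, Nat.add_eq_zero_iff, OfNat.ofNat_ne_zero, and_false, not_false_eq_true, zero_pow, sub_zero]
    rcases lt_or_gt_of_ne ht' with h | h
    · rw [max_eq_right h.le]; simp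
    · rw [max_eq_left h.le]; field_simp; ring
  · have : (fun s : ℝ => (max s 0) ^ (m + 2)) =ᶠ[𝓝 s] fun s => s ^ (m + 2) := by
      filter_upwards [lt_mem_nhds h] with t ht
      rw [max_eq_left ht.le]
    rw [max_eq_left h.le]
    have h2 := (hasDerivAt_pow (m + 2) s).congr_of_eventuallyEq this
    simpa using h2

theorem thp_contDiff (p : ℕ) : ContDiff ℝ p (fun s : ℝ => (max s 0) ^ (p + 1)) := by
  induction p with
  | zero => exact contDiff_zero.2 (by fun_prop)
  | succ p ih =>
    push_cast
    rw [contDiff_succ_iff_deriv]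
    refine ⟨fun s => (thp_hasDeriv p s).differentiableAt, by simp, ?_⟩
    have : deriv (fun s : ℝ => (max s 0) ^ (p + 1 + 1)) = fun s => ((p:ℝ) + 2) * (max s 0) ^ (p + 1) :=
      funext fun s => (thp_hasDeriv p s).deriv
    rw [this]
    exact contDiff_const.mul ih

/-- numerator and denominator pieces of a cutoff -/
def bet (p : ℕ) (s : ℝ) : ℝ :=
  (max (1/2 - s) 0) ^ (p + 1) / ((max (1/2 - s) 0) ^ (p + 1) + (max (s - 1/4) 0) ^ (p + 1))

theorem bet_den (p : ℕ) (s : ℝ) : 0 < (max (1/2 - s) 0) ^ (p + 1) + (max (s - 1/4) 0) ^ (p + 1) := by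
  by_cases h : s < 1/2
  · have : 0 < max (1/2 - s) 0 := lt_max_of_lt_left (by linarith)
    positivity
  · have : 0 < max (s - 1/4) 0 := lt_max_of_lt_left (by linarith)
    positivity

theorem bet_contDiff (p : ℕ) : ContDiff ℝ p (bet p) := by
  have h1 : ContDiff ℝ p (fun s : ℝ => (max (1/2 - s) 0) ^ (p + 1)) :=
    (thp_contDiff p).comp (f := fun s : ℝ => 1/2 - s) (by fun_prop)
  have h2 : ContDiff ℝ p (fun s : ℝ => (max (s - 1/4) 0) ^ (p + 1)) :=
    (thp_contDiff p).comp (f := fun s : ℝ => s - 1/4) (by fun_prop)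
  exact h1.div (h1.add h2) fun s => (bet_den p s).ne'

theorem bet_nonneg (p : ℕ) (s : ℝ) : 0 ≤ bet p s := by unfold bet; positivity

theorem bet_le_one (p : ℕ) (s : ℝ) : bet p s ≤ 1 := by
  unfold bet
  rw [div_le_one (bet_den p s)]
  have : 0 ≤ (max (s - 1/4) 0) ^ (p + 1) := by positivity
  linarith

theorem bet_one (p : ℕ) {s : ℝ} (h : s ≤ 1/4) : bet p s = 1 := by
  have h1 := bet_den p s
  unfold bet
  rw [max_eq_right (a := s - 1/4) (by linarith)] at *
  simp only [ne_eq, Nat.add_eq_zero_iff, one_ne_zero, and_false, not_false_eq_true, zero_pow, add_zero] at *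
  exact div_self h1.ne'

theorem bet_zero (p : ℕ) {s : ℝ} (h : 1/2 ≤ s) : bet p s = 0 := by
  unfold bet
  rw [max_eq_right (a := 1/2 - s) (by linarith)]
  simp

variable {L : FirstOrder.Language} [L.Structure ℝ] [hE : Fact (ExpandsOrderedField L)]

theorem DF.bet (p : ℕ) : DF L (bet p) := by
  unfold DMinPaper.bet; fun_prop
end cutoff

section tube
variable {L : FirstOrder.Language} [L.Structure ℝ] [hE : Fact (ExpandsOrderedField L)]
variable {n d : ℕ}

/-- locally bounded above on `S` -/
def LBd (S : Set (Fin n → ℝ)) (h : (Fin n → ℝ) → ℝ) : Prop :=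
  ∀ x ∈ S, ∃ C, ∀ᶠ x' in 𝓝 x, x' ∈ S → h x' ≤ C

theorem recip {S : Set (Fin n → ℝ)} {bad : (Fin n → ℝ) → (Fin n → ℝ) → Prop}
    (hbad : DP L (fun q : (Fin n → ℝ) × (Fin n → ℝ) => bad q.1 q.2))
    (hr : ∀ b ∈ S, ∃ r > 0, ∀ᶠ b' in 𝓝 b, b' ∈ S → ∀ x, bad b' x → r ≤ dist x b') :
    ∃ k, DF L k ∧ (∀ b ∈ S, 1 ≤ k b ∧ ∀ x, bad b x → 1 ≤ k b * dist x b) ∧ LBd S k := by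
  refine ⟨fun b => sInf {c | 1 ≤ c ∧ ∀ x, bad b x → 1 ≤ c * dist x b}, ?_, ?_, ?_⟩
  · refine DF.sInf (DP.and (DP.le (by fun_prop) (by fun_prop)) (DP.all (DP.imp ?_ (DP.le (by fun_prop) (by fun_prop)))))
    exact hbad.comp (f := fun q : ((Fin n → ℝ) × ℝ) × (Fin n → ℝ) => (q.1.1, q.2)) (by fun_prop)
  · intro b hb
    obtain ⟨r, hr0, hr1⟩ := hr b hb
    have hr2 := hr1.self_of_nhds hb
    have hne : {c | 1 ≤ c ∧ ∀ x, bad b x → 1 ≤ c * dist x b}.Nonempty := by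
      refine ⟨max 1 (1/r), le_max_left _ _, fun x hx => ?_⟩
      calc (1:ℝ) = 1/r * r := by field_simp
        _ ≤ max 1 (1/r) * dist x b := by
          gcongr
          · exact le_max_right _ _
          · exact hr2 x hx
    refine ⟨le_csInf hne fun c hc => hc.1, fun x hx => ?_⟩
    have hd : 0 < dist x b := hr0.trans_le (hr2 x hx)
    rw [← div_le_iff₀ hd]
    refine le_csInf hne fun c hc => ?_
    rw [div_le_iff₀ hd]
    exact hc.2 x hx
  · intro b hb
    obtain ⟨r, hr0, hr1⟩ := hr b hb
    refine ⟨max 1 (1/r), ?_⟩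
    filter_upwards [hr1] with b' hr2 hb'
    refine csInf_le ⟨1, fun c hc => hc.1⟩ ⟨le_max_left _ _, fun x hx => ?_⟩
    calc (1:ℝ) = 1/r * r := by field_simp
      _ ≤ max 1 (1/r) * dist x b' := by
        gcongr
        · exact le_max_right _ _
        · exact hr2 hb' x hx

/-- squared euclidean distance -/
def Qd (z b : Fin n → ℝ) : ℝ := ∑ i, (z i - b i) ^ 2

theorem dist_sq_le (z b : Fin n → ℝ) : dist z b ^ 2 ≤ Qd z b := by
  have h0 : 0 ≤ Qd z b := Finset.sum_nonneg fun i _ => sq_nonneg _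
  have : dist z b ≤ √(Qd z b) := by
    refine (dist_pi_le_iff (Real.sqrt_nonneg _)).2 fun i => ?_
    rw [Real.dist_eq]
    refine Real.abs_le_sqrt ?_
    exact Finset.single_le_sum (f := fun i => (z i - b i) ^ 2) (fun i _ => sq_nonneg _) (Finset.mem_univ i)
  calc dist z b ^ 2 ≤ √(Qd z b) ^ 2 := by gcongr
    _ = Qd z b := Real.sq_sqrt h0

theorem Qd_self (z : Fin n → ℝ) : Qd z z = 0 := by simp [Qd]

theorem Qd_contDiff (p : ℕ) : ContDiff ℝ p (fun q : (Fin n → ℝ) × (Fin n → ℝ) => Qd q.1 q.2) := by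
  unfold Qd
  refine ContDiff.sum fun i _ => ?_
  have h1 : ContDiff ℝ p (fun q : (Fin n → ℝ) × (Fin n → ℝ) => q.1 i) :=
    (contDiff_apply ℝ ℝ i).comp contDiff_fst
  have h2 : ContDiff ℝ p (fun q : (Fin n → ℝ) × (Fin n → ℝ) => q.2 i) :=
    (contDiff_apply ℝ ℝ i).comp contDiff_snd
  exact (h1.sub h2).pow 2

theorem DF.Qd {Γ : Type} [PseudoMetricSpace Γ] [DS Γ] {f g : Γ → Fin n → ℝ} (hf : DF L f) (hg : DF L g) :
    DF L (fun z => Qd (f z) (g z)) := by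
  unfold DMinPaper.Qd
  refine DF.sum _ fun i => ?_
  exact (((DF.apply i).comp hf).sub ((DF.apply i).comp hg)).pow 2

/-- tube relation -/
def TT (ι : Fin d → Fin n) (S : Set (Fin n → ℝ)) (k : (Fin n → ℝ) → ℝ) (z b : Fin n → ℝ) : Prop :=
  (b ∈ S ∧ projc ι b = projc ι z) ∧ 4 * Qd z b * (k b) ^ 2 < 1

/-- separation -/
def Sep (ι : Fin d → Fin n) (S : Set (Fin n → ℝ)) (k : (Fin n → ℝ) → ℝ) : Prop :=
  ∀ b ∈ S, 1 ≤ k b ∧ ∀ x ∈ S, projc ι x = projc ι b → x ≠ b → 1 ≤ k b * dist x b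

theorem DP.TT {ι : Fin d → Fin n} {S : Set (Fin n → ℝ)} (hS : DP L (fun x => x ∈ S))
    {k : (Fin n → ℝ) → ℝ} (hk : DF L k) :
    DP L (fun q : (Fin n → ℝ) × (Fin n → ℝ) => TT ι S k q.1 q.2) := by
  refine ((hS.comp DF.snd).and (DP.eq (by fun_prop) (by fun_prop))).and (DP.lt ?_ (by fun_prop))
  have : DF L (fun q : (Fin n → ℝ) × (Fin n → ℝ) => Qd q.1 q.2) := DF.Qd DF.fst DF.snd
  fun_prop

theorem TT.dist_lt {ι : Fin d → Fin n} {S : Set (Fin n → ℝ)} {k : (Fin n → ℝ) → ℝ} {z b : Fin n → ℝ}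
    (h : TT ι S k z b) (hk : 0 ≤ k b) : 2 * (k b * dist z b) < 1 := by
  have h1 := dist_sq_le z b
  have h2 := h.2
  have h3 : (2 * (k b * dist z b)) ^ 2 < 1 := by
    have : dist z b ^ 2 * (k b) ^ 2 ≤ Qd z b * (k b) ^ 2 := by gcongr
    nlinarith
  have h4 : 0 ≤ 2 * (k b * dist z b) := by positivity
  nlinarith

theorem TT.uniq {ι : Fin d → Fin n} {S : Set (Fin n → ℝ)} {k : (Fin n → ℝ) → ℝ} (hs : Sep ι S k)
    {z b b' : Fin n → ℝ} (h : TT ι S k z b) (h' : TT ι S k z b') : b' = b := by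
  by_contra hne
  have s1 := hs b h.1.1
  have s2 := hs b' h'.1.1
  have e1 := s1.2 b' h'.1.1 (h'.1.2.trans h.1.2.symm) hne
  have e2 := s2.2 b h.1.1 (h.1.2.trans h'.1.2.symm) (Ne.symm hne)
  have d1 := h.dist_lt (by linarith [s1.1])
  have d2 := h'.dist_lt (by linarith [s2.1])
  have tr := dist_triangle_left b' b z
  rw [dist_comm b b'] at e2
  have c1 : 2 * dist z b < dist b' b := by
    by_contra hh
    have : k b * dist b' b ≤ k b * (2 * dist z b) := mul_le_mul_of_nonneg_left (not_lt.1 hh) (by linarith [s1.1])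
    linarith
  have c2 : 2 * dist z b' < dist b' b := by
    by_contra hh
    have : k b' * dist b' b ≤ k b' * (2 * dist z b') := mul_le_mul_of_nonneg_left (not_lt.1 hh) (by linarith [s2.1])
    linarith
  linarith

theorem TT.exu {ι : Fin d → Fin n} {S : Set (Fin n → ℝ)} {k : (Fin n → ℝ) → ℝ} (hs : Sep ι S k)
    {z b : Fin n → ℝ} (h : TT ι S k z b) : ∃! b, TT ι S k z b :=
  ⟨b, h, fun _ h' => TT.uniq hs h h'⟩

theorem MG.sep {p : ℕ} {ι : Fin d → Fin n} {S : Set (Fin n → ℝ)} {h : (Fin n → ℝ) → ℝ} (hMG : MG p ι S h) :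
    ∀ b ∈ S, ∃ r > 0, ∀ᶠ b' in 𝓝 b, b' ∈ S → ∀ x, (x ∈ S ∧ projc ι x = projc ι b') ∧ x ≠ b' → r ≤ dist x b' := by
  intro b hb
  obtain ⟨U, σ, hU, hbU, -, -, hσ⟩ := hMG b hb
  obtain ⟨r, hr, hball⟩ := Metric.isOpen_iff.1 hU b hbU
  refine ⟨r/2, by positivity, ?_⟩
  filter_upwards [((continuous_projc ι).tendsto b).eventually hσ, Metric.ball_mem_nhds b (half_pos hr)]
    with b' h1 h2 hb' x hx
  by_contra hlt
  apply hx.2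
  have hxU : x ∈ U := hball (by
    rw [Metric.mem_ball] at *
    have := dist_triangle x b' b
    linarith)
  have hbU' : b' ∈ U := hball (by rw [Metric.mem_ball] at *; linarith)
  exact (h1.2 x hx.1.1 hxU hx.1.2).trans (h1.2 b' hb' hbU' rfl).symm

/-- local section, with the tube -/
theorem MG.section' {p : ℕ} {ι : Fin d → Fin n} {S : Set (Fin n → ℝ)} {h : (Fin n → ℝ) → ℝ} (hMG : MG p ι S h)
    {b : Fin n → ℝ} (hb : b ∈ S) : ∃ σ : (Fin d → ℝ) → (Fin n → ℝ), ContDiffAt ℝ p σ (projc ι b) ∧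
      ContDiffAt ℝ p (fun y => h (σ y)) (projc ι b) ∧ σ (projc ι b) = b ∧
      ∀ᶠ y in 𝓝 (projc ι b), σ y ∈ S ∧ projc ι (σ y) = y := by
  obtain ⟨U, σ, hU, hbU, h1, h2, hσ⟩ := hMG b hb
  refine ⟨σ, h1, h2, (hσ.self_of_nhds.2 b hb hbU rfl).symm, ?_⟩
  filter_upwards [hσ] with y hy using ⟨hy.1.1, hy.1.2.2⟩

theorem projc_contDiff (p : ℕ) (ι : Fin d → Fin n) : ContDiff ℝ p (projc ι) :=
  contDiff_pi.2 fun i => contDiff_apply ℝ ℝ (ι i)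

/-- domination on a stratum -/
theorem dom_stratum {p : ℕ} {ι : Fin d → Fin n} {S : Set (Fin n → ℝ)} (hS : DP L (fun x => x ∈ S))
    {h : (Fin n → ℝ) → ℝ} (hh : DF L h) (hMG : MG p ι S h) :
    ∃ g, DF L g ∧ ∀ x ∈ S, ContDiffAt ℝ p g x ∧ h x ≤ g x := by
  have hb : DP L (fun q : (Fin n → ℝ) × (Fin n → ℝ) => (q.2 ∈ S ∧ projc ι q.2 = projc ι q.1) ∧ q.2 ≠ q.1) :=
    ((hS.comp DF.snd).and (DP.eq (by fun_prop) (by fun_prop))).and (DP.eq (by fun_prop) (by fun_prop)).not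
  obtain ⟨k, hk, hk1, hk2⟩ := recip (S := S) (bad := fun b x => (x ∈ S ∧ projc ι x = projc ι b) ∧ x ≠ b) hb hMG.sep
  have hsep : Sep ι S k := fun b hb => ⟨(hk1 b hb).1, fun x hx h1 h2 => (hk1 b hb).2 x ⟨⟨hx, h1⟩, h2⟩⟩
  refine ⟨fun z => h (the (TT ι S k) z), hh.comp (DF.the (DP.TT hS hk)), fun x hx => ?_⟩
  obtain ⟨σ, h1, h2, h3, h4⟩ := hMG.section' hx
  have hπ := (continuous_projc ι).tendsto x
  have hσt : Tendsto (fun z => σ (projc ι z)) (𝓝 x) (𝓝 x) := by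
    have := h1.continuousAt.tendsto.comp hπ
    rwa [h3] at this
  obtain ⟨C, hC⟩ := hk2 x hx
  have hq : Tendsto (fun z => 4 * Qd z (σ (projc ι z)) * C ^ 2) (𝓝 x) (𝓝 0) := by
    have h5 := ((Qd_contDiff (n := n) 0).continuous.tendsto (x, x)).comp (tendsto_id.prodMk_nhds hσt)
    simp only [Qd_self] at h5
    have := (h5.const_mul 4).mul_const (C ^ 2)
    simpa using this
  have key : ∀ᶠ z in 𝓝 x, the (TT ι S k) z = σ (projc ι z) := by
    filter_upwards [hπ.eventually h4, hσt.eventually hC, hq.eventually (gt_mem_nhds one_pos)] with z h5 h6 h7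
    have hT : TT ι S k z (σ (projc ι z)) := by
      refine ⟨h5, lt_of_le_of_lt ?_ h7⟩
      have h0 : 0 ≤ Qd z (σ (projc ι z)) := (sq_nonneg _).trans (dist_sq_le _ _)
      have h8 := h6 h5.1
      have h9 := (hsep _ h5.1).1
      have : k (σ (projc ι z)) ^ 2 ≤ C ^ 2 := by gcongr
      gcongr
    exact the_eq (TT.exu hsep hT) hT
  constructor
  · have h5 : ContDiffAt ℝ p (fun z => h (σ (projc ι z))) x :=
      ContDiffAt.comp (f := projc ι) (g := fun y => h (σ y)) x h2 (projc_contDiff p ι).contDiffAt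
    refine h5.congr_of_eventuallyEq ?_
    filter_upwards [key] with z hz
    rw [hz]
  · change h x ≤ h (the (TT ι S k) x)
    rw [key.self_of_nhds, h3]
end tube

section main
variable {L : FirstOrder.Language} [L.Structure ℝ] [hE : Fact (ExpandsOrderedField L)]
variable {n d : ℕ}

/-- frontier part outside the set -/
def fr (X : Set (Fin n → ℝ)) : Set (Fin n → ℝ) := closure X \ X

/-- local closedness -/
def LC (X : Set (Fin n → ℝ)) : Prop := ∀ x ∈ X, ∀ᶠ x' in 𝓝 x, x' ∉ fr X

theorem DP.fr {X : Set (Fin n → ℝ)} (hX : DP L (fun x => x ∈ X)) : DP L (fun x => x ∈ fr X) := by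
  have h1 : DP L (fun x : Fin n → ℝ => ∀ᶠ x' in 𝓝 x, x' ∉ X) :=
    DP.ev (P := fun _ x' => x' ∉ X) DF.id (hX.not.comp DF.snd)
  refine (h1.not.and hX.not).congr fun x => ?_
  change (x ∈ closure X ∧ x ∉ X) ↔ _
  rw [mem_closure_iff_frequently]
  rfl

theorem LC.ropen {S Y : Set (Fin n → ℝ)} (h : ROpen S Y) (hY : LC Y) : LC S := by
  intro x hx
  filter_upwards [hY x (h.1 hx), h.2 x hx] with x' h1 h2 h3
  refine h3.2 (h2 ?_)
  by_contra h4
  exact h1 ⟨closure_mono h.1 h3.1, h4⟩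

theorem ROpen.notin {S Y : Set (Fin n → ℝ)} (h : ROpen S Y) {x : Fin n → ℝ} (hx : x ∈ S) : x ∉ closure (Y \ S) := by
  rw [mem_closure_iff_frequently]
  intro h1
  obtain ⟨x', h2, h3⟩ := (h1.and_eventually (h.2 x hx)).exists
  exact h2.2 (h3 h2.1)

theorem LC.rclosed {S Y : Set (Fin n → ℝ)} (h : ROpen S Y) (hY : LC Y) : LC (Y \ S) := by
  intro x hx
  filter_upwards [hY x hx.1] with x' h1 h3
  have hxY : x' ∈ Y := by
    by_contra h4
    exact h1 ⟨closure_mono sdiff_subset h3.1, h4⟩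
  refine h3.2 ⟨hxY, fun hS => ?_⟩
  exact h.notin hS h3.1

/-- domination property -/
def Dom (L : FirstOrder.Language) [L.Structure ℝ] (p : ℕ) (X : Set (Fin n → ℝ)) : Prop :=
  ∀ h : (Fin n → ℝ) → ℝ, DF L h → LBd X h → ∃ g : (Fin n → ℝ) → ℝ, DF L g ∧ ∀ x ∈ X, ContDiffAt ℝ p g x ∧ h x ≤ g x

/-- cutoff property -/
def Cut (L : FirstOrder.Language) [L.Structure ℝ] (p : ℕ) (X : Set (Fin n → ℝ)) : Prop :=
  ∀ V : Set (Fin n → ℝ), DP L (fun x => x ∈ V) → IsOpen V → X ⊆ V →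
    ∃ χ : (Fin n → ℝ) → ℝ, DF L χ ∧ (∀ z, 0 ≤ χ z ∧ χ z ≤ 1) ∧ (∀ x ∈ X, ∀ᶠ z in 𝓝 x, χ z = 1) ∧
      (∀ x ∉ fr X, ContDiffAt ℝ p χ x) ∧ (∀ x ∉ fr X, x ∉ V → ∀ᶠ z in 𝓝 x, χ z = 0)

theorem cut_stratum {p : ℕ} {ι : Fin d → Fin n} {S : Set (Fin n → ℝ)} (hS : DP L (fun x => x ∈ S))
    {h : (Fin n → ℝ) → ℝ} (hMG : MG p ι S h) (hlc : LC S) (hdom : Dom L p S) : Cut L p S := by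
  intro V hV hVo hSV
  obtain ⟨k, hk, hk1, hk2⟩ := recip (L := L) (S := S)
    (bad := fun b x => x ∈ fr S ∨ x ∉ V ∨ ((x ∈ S ∧ projc ι x = projc ι b) ∧ x ≠ b))
    ((hS.fr.comp DF.snd).or ((hV.not.comp DF.snd).or
      (((hS.comp DF.snd).and (DP.eq (by fun_prop) (by fun_prop))).and (DP.eq (by fun_prop) (by fun_prop)).not)))
    (by
      intro b hb
      obtain ⟨r1, hr1, h1⟩ := Metric.eventually_nhds_iff.1 (hlc b hb)
      obtain ⟨r2, hr2, h2⟩ := Metric.isOpen_iff.1 hVo b (hSV hb)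
      obtain ⟨r3, hr3, h3⟩ := hMG.sep b hb
      refine ⟨min (r1/2) (min (r2/2) r3), by positivity, ?_⟩
      filter_upwards [h3, Metric.ball_mem_nhds b (half_pos hr1), Metric.ball_mem_nhds b (half_pos hr2)]
        with b' a1 a2 a3 hb' x hx
      rw [Metric.mem_ball] at a2 a3
      have htri := dist_triangle x b' b
      rcases hx with hx | hx | hx
      · refine (min_le_left _ _).trans ?_
        by_contra hlt
        exact h1 (show dist x b < r1 by linarith) hx
      · refine (min_le_right _ _).trans ((min_le_left _ _).trans ?_)
        by_contra hlt
        exact hx (h2 (Metric.mem_ball.2 (by linarith)))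
      · exact (min_le_right _ _).trans ((min_le_right _ _).trans (a1 hb' x hx)))
  obtain ⟨g, hg, hg1⟩ := hdom k hk hk2
  have gone : ∀ b ∈ S, 1 ≤ g b := fun b hb => (hk1 b hb).1.trans (hg1 b hb).2
  have gbad : ∀ b ∈ S, ∀ x, (x ∈ fr S ∨ x ∉ V ∨ ((x ∈ S ∧ projc ι x = projc ι b) ∧ x ≠ b)) → 1 ≤ g b * dist x b := by
    intro b hb x hx
    refine ((hk1 b hb).2 x hx).trans ?_
    have := (hg1 b hb).2
    gcongr
  have hsep : Sep ι S g := fun b hb => ⟨gone b hb, fun x hx h1 h2 => gbad b hb x (Or.inr (Or.inr ⟨⟨hx, h1⟩, h2⟩))⟩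
  have hT : DP L (fun q : (Fin n → ℝ) × (Fin n → ℝ) => TT ι S g q.1 q.2) := DP.TT hS hg
  have hρ : DF L (the (TT ι S g)) := DF.the hT
  obtain ⟨χ, hχ⟩ : ∃ χ : (Fin n → ℝ) → ℝ, χ = fun z => if (∃ b, TT ι S g z b) then
    bet p (4 * Qd z (the (TT ι S g) z) * g (the (TT ι S g) z) ^ 2) else 0 := ⟨_, rfl⟩
  have χT : ∀ z b, TT ι S g z b → χ z = bet p (4 * Qd z b * g b ^ 2) := by
    intro z b hzb
    rw [hχ]
    simp only
    rw [if_pos ⟨b, hzb⟩, the_eq (TT.exu hsep hzb) hzb]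
  have χN : ∀ z, (¬ ∃ b, TT ι S g z b) → χ z = 0 := by
    intro z hz
    rw [hχ]
    simp only
    rw [if_neg hz]
  -- behaviour in the tube
  have inT : ∀ z b, TT ι S g z b → ContDiffAt ℝ p χ z ∧ (z ∈ S → ∀ᶠ z' in 𝓝 z, χ z' = 1) := by
    intro z0 b hzb
    obtain ⟨σ, h1, -, h3, h4⟩ := hMG.section' hzb.1.1
    have hπ := (continuous_projc ι).tendsto z0
    rw [hzb.1.2] at h1 h3 h4
    have c1 : ContDiffAt ℝ p (fun z => σ (projc ι z)) z0 :=
      ContDiffAt.comp (f := projc ι) (g := σ) z0 h1 (projc_contDiff p ι).contDiffAt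
    have c2 : ContDiffAt ℝ p (fun z => g (σ (projc ι z))) z0 := by
      refine ContDiffAt.comp (f := fun z => σ (projc ι z)) (g := g) z0 ?_ c1
      rw [h3]; exact (hg1 b hzb.1.1).1
    have c3 : ContDiffAt ℝ p (fun z => Qd z (σ (projc ι z))) z0 :=
      ContDiffAt.comp (f := fun z => (z, σ (projc ι z))) (g := fun q : (Fin n → ℝ) × (Fin n → ℝ) => Qd q.1 q.2) z0
        (Qd_contDiff p).contDiffAt (contDiffAt_id.prodMk c1)
    have c4 : ContDiffAt ℝ p (fun z => 4 * Qd z (σ (projc ι z)) * g (σ (projc ι z)) ^ 2) z0 :=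
      (contDiffAt_const.mul c3).mul (c2.pow 2)
    have hlim := c4.continuousAt.tendsto
    have hev : ∀ᶠ z in 𝓝 z0, TT ι S g z (σ (projc ι z)) := by
      have hlt : 4 * Qd z0 (σ (projc ι z0)) * g (σ (projc ι z0)) ^ 2 < 1 := by rw [h3]; exact hzb.2
      filter_upwards [hlim.eventually (gt_mem_nhds hlt), hπ.eventually h4] with z a1 a2
      exact ⟨a2, a1⟩
    constructor
    · have c5 : ContDiffAt ℝ p (fun z => bet p (4 * Qd z (σ (projc ι z)) * g (σ (projc ι z)) ^ 2)) z0 :=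
        ContDiffAt.comp (g := bet p) z0 (bet_contDiff p).contDiffAt c4
      refine c5.congr_of_eventuallyEq ?_
      filter_upwards [hev] with z hz
      exact χT z _ hz
    · intro hz0
      have hzz : TT ι S g z0 z0 := ⟨⟨hz0, rfl⟩, by simp [Qd_self]⟩
      have hb : b = z0 := TT.uniq hsep hzz hzb
      have hlt : 4 * Qd z0 (σ (projc ι z0)) * g (σ (projc ι z0)) ^ 2 < 1/4 := by
        rw [h3, hb, Qd_self]; norm_num
      filter_upwards [hlim.eventually (gt_mem_nhds hlt), hev] with z a1 a2
      rw [χT z _ a2]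
      exact bet_one p a1.le
  have outT : ∀ z, z ∉ fr S → (¬ ∃ b, TT ι S g z b) → ∀ᶠ z' in 𝓝 z, χ z' = 0 := by
    intro z0 hz0 hno
    by_contra hcon
    have hf : ∃ᶠ z in 𝓝 z0, ∃ b, TT ι S g z b ∧ 4 * Qd z b * g b ^ 2 ≤ 1/2 := by
      refine Frequently.mono (not_eventually.1 hcon) fun z hz => ?_
      by_cases hb : ∃ b, TT ι S g z b
      · obtain ⟨b, hb⟩ := hb
        refine ⟨b, hb, ?_⟩
        by_contra hlt
        apply hz
        rw [χT z b hb]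
        exact bet_zero p (not_le.1 hlt).le
      · exact absurd (χN z hb) hz
    obtain ⟨z, hz, hz1⟩ := exists_seq_forall_of_frequently (hf.and_eventually (Metric.ball_mem_nhds z0 one_pos))
    choose b hb using fun k => (hz1 k).1
    have hd : ∀ k, 2 * (g (b k) * dist (z k) (b k)) < 1 := fun k => (hb k).1.dist_lt (by linarith [gone _ (hb k).1.1.1])
    have hbd : ∀ k, b k ∈ Metric.ball z0 2 := by
      intro k
      have h1 := gone _ (hb k).1.1.1
      have h2 := hd k
      have h3 := (hz1 k).2
      rw [Metric.mem_ball] at *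
      have h4 := dist_triangle_left (b k) z0 (z k)
      have h5 : 1 * dist (z k) (b k) ≤ g (b k) * dist (z k) (b k) := by gcongr
      linarith
    obtain ⟨bs, -, φ, hφ, hlim⟩ := tendsto_subseq_of_bounded Metric.isBounded_ball hbd
    have hzφ := hz.comp hφ.tendsto_atTop
    have hcl : bs ∈ closure S := mem_closure_of_tendsto hlim (Eventually.of_forall fun k => (hb _).1.1.1)
    by_cases hbs : bs ∈ S
    · apply hno
      refine ⟨bs, ⟨hbs, ?_⟩, ?_⟩
      · have e1 := ((continuous_projc ι).tendsto bs).comp hlim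
        have e2 := ((continuous_projc ι).tendsto z0).comp hzφ
        refine tendsto_nhds_unique e1 (e2.congr fun k => ?_)
        exact (hb (φ k)).1.1.2.symm
      · have e1 := ((hg1 bs hbs).1.continuousAt.tendsto).comp hlim
        have e2 := ((Qd_contDiff (n := n) 0).continuous.tendsto (z0, bs)).comp (hzφ.prodMk_nhds hlim)
        have e3 := (e2.const_mul 4).mul (e1.pow 2)
        have := le_of_tendsto e3 (Eventually.of_forall fun k => (hb (φ k)).2)
        refine lt_of_le_of_lt this (by norm_num)
    · have hfr : bs ∈ fr S := ⟨hcl, hbs⟩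
      have e1 : dist z0 bs ≤ dist bs bs := by
        refine le_of_tendsto_of_tendsto' (hzφ.dist hlim) (tendsto_const_nhds.dist hlim) fun k => ?_
        have a1 := gbad _ (hb (φ k)).1.1.1 bs (Or.inl hfr)
        have a2 := hd (φ k)
        have a3 := gone _ (hb (φ k)).1.1.1
        change dist (z (φ k)) (b (φ k)) ≤ dist bs (b (φ k))
        by_contra hlt
        have := mul_le_mul_of_nonneg_left (not_le.1 hlt).le (show 0 ≤ g (b (φ k)) by linarith)
        linarith
      rw [dist_self] at e1
      have : z0 = bs := dist_le_zero.1 e1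
      exact hz0 (this ▸ hfr)
  refine ⟨χ, ?_, ?_, ?_, ?_, ?_⟩
  · rw [hχ]
    refine DF.ite (DP.ex hT) ?_ (DF.const 0)
    have h1 : DF L (fun z => Qd z (the (TT ι S g) z)) := DF.Qd DF.id hρ
    have h2 : DF L (fun z => g (the (TT ι S g) z)) := hg.comp hρ
    have h3 : DF L (fun z => 4 * Qd z (the (TT ι S g) z) * g (the (TT ι S g) z) ^ 2) :=
      ((DF.const 4).mul h1).mul (h2.pow 2)
    exact (DF.bet p).comp h3
  · intro z
    by_cases hz : ∃ b, TT ι S g z b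
    · obtain ⟨b, hb⟩ := hz
      rw [χT z b hb]
      exact ⟨bet_nonneg _ _, bet_le_one _ _⟩
    · rw [χN z hz]; norm_num
  · intro x hx
    exact (inT x x ⟨⟨hx, rfl⟩, by simp [Qd_self]⟩).2 hx
  · intro x hx
    by_cases hz : ∃ b, TT ι S g x b
    · obtain ⟨b, hb⟩ := hz
      exact (inT x b hb).1
    · exact contDiffAt_const.congr_of_eventuallyEq (outT x hx hz)
  · intro x hx hxV
    refine outT x hx ?_
    rintro ⟨b, hb⟩
    have a1 := gbad b hb.1.1 x (Or.inr (Or.inl hxV))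
    have a2 := hb.dist_lt (by linarith [gone b hb.1.1])
    linarith

theorem glue_dom {p : ℕ} {S Y : Set (Fin n → ℝ)} (hY : DP L (fun x => x ∈ Y)) 
    (hSY : ROpen S Y) (hD : Dom L p (Y \ S)) (hC : Cut L p (Y \ S))
    {h : (Fin n → ℝ) → ℝ} (hh : DF L h) (hb : LBd Y h) {gS : (Fin n → ℝ) → ℝ} (hgS : DF L gS)
    (hgS1 : ∀ x ∈ S, ContDiffAt ℝ p gS x ∧ h x ≤ gS x) :
    ∃ g : (Fin n → ℝ) → ℝ, DF L g ∧ ∀ x ∈ Y, ContDiffAt ℝ p g x ∧ h x ≤ g x := by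
  let H : (Fin n → ℝ) → ℝ := fun x => sInf {c | 0 ≤ c ∧ ∀ᶠ x' in 𝓝 x, x' ∈ Y → h x' ≤ c} + 1
  have hH : DF L H := by
    refine (DF.sInf (DP.and (DP.le (by fun_prop) (by fun_prop)) (DP.ev (P := fun (q : (Fin n → ℝ) × ℝ) x' => x' ∈ Y → h x' ≤ q.2) DF.fst
      (DP.imp (hY.comp DF.snd) (DP.le (by fun_prop) (by fun_prop)))))).add (DF.const 1)
  have hbb : ∀ x, BddBelow {c | 0 ≤ c ∧ ∀ᶠ x' in 𝓝 x, x' ∈ Y → h x' ≤ c} := fun x => ⟨0, fun c hc => hc.1⟩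
  have hne : ∀ x ∈ Y, ∃ C, 0 ≤ C ∧ ∀ᶠ x' in 𝓝 x, x' ∈ Y → h x' ≤ C := by
    intro x hx
    obtain ⟨C, hC⟩ := hb x hx
    refine ⟨max 0 C, le_max_left _ _, ?_⟩
    filter_upwards [hC] with x' h1 h2 using (h1 h2).trans (le_max_right _ _)
  have hHb : LBd (Y \ S) H := by
    intro x hx
    obtain ⟨C, hC0, hC⟩ := hne x hx.1
    refine ⟨C + 1, ?_⟩
    filter_upwards [hC.eventually_nhds] with x' h1 _
    have := csInf_le (hbb x') ⟨hC0, h1⟩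
    change sInf _ + 1 ≤ C + 1
    linarith
  have hH1 : ∀ x ∈ Y, ∀ᶠ x' in 𝓝 x, x' ∈ Y → h x' < H x - 1/2 := by
    intro x hx
    have := exists_lt_of_csInf_lt (hne x hx) (show sInf {c | 0 ≤ c ∧ ∀ᶠ x' in 𝓝 x, x' ∈ Y → h x' ≤ c} < H x - 1/2 by
      change _ < sInf _ + 1 - 1/2
      linarith)
    obtain ⟨c, hc, hlt⟩ := this
    filter_upwards [hc.2] with x' h1 h2
    exact (h1 h2).trans_lt hlt
  obtain ⟨gZ, hgZ, hgZ1⟩ := hD H hH hHb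
  let V : Set (Fin n → ℝ) := {x | ContDiffAt ℝ p gZ x ∧ ∀ᶠ x' in 𝓝 x, x' ∈ Y → h x' ≤ gZ x'}
  have hV : DP L (fun x => x ∈ V) := (DP.contDiffAt' p hgZ).and
    (DP.ev (P := fun _ x' => x' ∈ Y → h x' ≤ gZ x') DF.id (DP.imp (hY.comp DF.snd) (DP.le (by fun_prop) (by fun_prop))))
  have hVo : IsOpen V := by
    rw [isOpen_iff_mem_nhds]
    intro x hx
    filter_upwards [cd_ev hx.1, hx.2.eventually_nhds] with x' h1 h2 using ⟨h1, h2⟩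
  have hZV : Y \ S ⊆ V := by
    intro x hx
    refine ⟨(hgZ1 x hx).1, ?_⟩
    have hlt : H x - 1/2 < gZ x := by linarith [(hgZ1 x hx).2]
    filter_upwards [hH1 x hx.1, (hgZ1 x hx).1.continuousAt.tendsto.eventually (lt_mem_nhds hlt)] with x' h1 h2 h3
    linarith [h1 h3]
  obtain ⟨χ, hχ, hχ1, hχ2, hχ3, hχ4⟩ := hC V hV hVo hZV
  refine ⟨fun z => χ z * gZ z + (1 - χ z) * gS z, by fun_prop, fun x hx => ?_⟩
  by_cases hxS : x ∈ S
  · have hncl := hSY.notin hxS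
    have hnfr : x ∉ fr (Y \ S) := fun hf => hncl hf.1
    have hcS := (hgS1 x hxS).1
    have hcχ := hχ3 x hnfr
    by_cases hxV : x ∈ V
    · refine ⟨(hcχ.mul hxV.1).add ((contDiffAt_const.sub hcχ).mul hcS), ?_⟩
      have h1 := hxV.2.self_of_nhds hx
      have h2 := (hgS1 x hxS).2
      have h3 := hχ1 x
      change h x ≤ χ x * gZ x + (1 - χ x) * gS x
      nlinarith
    · have h0 := hχ4 x hnfr hxV
      constructor
      · refine hcS.congr_of_eventuallyEq ?_
        filter_upwards [h0] with z hz
        simp [hz]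
      · have := h0.self_of_nhds
        simp only [this]
        linarith [(hgS1 x hxS).2]
  · have hxZ : x ∈ Y \ S := ⟨hx, hxS⟩
    have h1 := hχ2 x hxZ
    constructor
    · refine (hgZ1 x hxZ).1.congr_of_eventuallyEq ?_
      filter_upwards [h1] with z hz
      simp [hz]
    · have := h1.self_of_nhds
      simp only [this]
      have := (hZV hxZ).2.self_of_nhds hx
      linarith

theorem glue_cut {p : ℕ} {S X : Set (Fin n → ℝ)} (hSX : S ⊆ X)
    (hS : Cut L p S) (hZ : Cut L p (X \ S)) : Cut L p X := by
  intro V hV hVo hXV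
  obtain ⟨f, f0, f1, f2, f3, f4⟩ := hS V hV hVo (hSX.trans hXV)
  obtain ⟨g, g0, g1, g2, g3, g4⟩ := hZ V hV hVo (sdiff_subset.trans hXV)
  have hone : ∀ x ∈ X, ∀ᶠ z in 𝓝 x, 1 - (1 - f z) * (1 - g z) = 1 := by
    intro x hx
    by_cases hxS : x ∈ S
    · filter_upwards [f2 x hxS] with z hz
      rw [hz]; ring
    · filter_upwards [g2 x ⟨hx, hxS⟩] with z hz
      rw [hz]; ring
  have hout : ∀ x ∉ fr X, x ∉ X → x ∉ fr S ∧ x ∉ fr (X \ S) := by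
    intro x hx hxX
    have hcl : x ∉ closure X := fun h => hx ⟨h, hxX⟩
    exact ⟨fun h => hcl (closure_mono hSX h.1), fun h => hcl (closure_mono sdiff_subset h.1)⟩
  refine ⟨fun z => 1 - (1 - f z) * (1 - g z), by fun_prop, ?_, hone, ?_, ?_⟩
  · intro z
    have a := f1 z
    have b := g1 z
    constructor <;> nlinarith [mul_nonneg (sub_nonneg.2 a.2) (sub_nonneg.2 b.2),
      mul_nonneg (sub_nonneg.2 a.2) b.1]
  · intro x hx
    by_cases hxX : x ∈ X
    · exact contDiffAt_const.congr_of_eventuallyEq (hone x hxX)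
    · obtain ⟨a, b⟩ := hout x hx hxX
      exact contDiffAt_const.sub ((contDiffAt_const.sub (f3 x a)).mul (contDiffAt_const.sub (g3 x b)))
  · intro x hx hxV
    obtain ⟨a, b⟩ := hout x hx (fun h => hxV (hXV h))
    filter_upwards [f4 x a hxV, g4 x b hxV] with z h1 h2
    rw [h1, h2]; ring

theorem dom_cut (hL : DMinimal L) (p : ℕ) : ∀ X : Set (Fin n → ℝ), DP L (fun x => x ∈ X) → LC X → Dom L p X ∧ Cut L p X := by
  refine strat hL p ?_
  intro X hX ih hlc
  have hdom : ∀ Y ⊆ X, DP L (fun x => x ∈ Y) → LC Y → Dom L p Y := by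
    intro Y hYX hY hlY h hh hb
    rcases Y.eq_empty_or_nonempty with rfl | hne
    · exact ⟨fun _ => 0, DF.const 0, fun x hx => hx.elim⟩
    obtain ⟨d, ι, S, hS, hSY, hMG, hP⟩ := ih Y hYX hY hne h hh
    obtain ⟨hD, hC⟩ := hP (hlY.rclosed hSY)
    obtain ⟨gS, hgS, hgS1⟩ := dom_stratum hS hh hMG
    exact glue_dom hY hSY hD hC hh hb hgS hgS1
  refine ⟨hdom X subset_rfl hX hlc, ?_⟩
  rcases X.eq_empty_or_nonempty with rfl | hne
  · intro V _ _ _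
    exact ⟨fun _ => 0, DF.const 0, fun z => by norm_num, fun x hx => hx.elim, fun x _ => contDiffAt_const,
      fun x _ _ => Eventually.of_forall fun _ => rfl⟩
  obtain ⟨d, ι, S, hS, hSY, hMG, hP⟩ := ih X subset_rfl hX hne (fun _ => 0) (DF.const 0)
  obtain ⟨hD, hC⟩ := hP (hlc.rclosed hSY)
  have hlS := hlc.ropen hSY
  exact glue_cut hSY.1 (cut_stratum hS hMG hlS (hdom S hSY.1 hS hlS)) hC
end main

section final
variable {L : FirstOrder.Language} [L.Structure ℝ] [hE : Fact (ExpandsOrderedField L)]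
variable {n d : ℕ}

/-- drop last coordinate -/
def ini (z : Fin (n + 1) → ℝ) : Fin n → ℝ := fun i => z i.castSucc

/-- append a coordinate -/
def sno (x : Fin n → ℝ) (t : ℝ) : Fin (n + 1) → ℝ := Fin.snoc (α := fun _ => ℝ) x t

theorem sno_last (x : Fin n → ℝ) (t : ℝ) : sno x t (Fin.last n) = t := by simp [sno]

theorem sno_cs (x : Fin n → ℝ) (t : ℝ) (i : Fin n) : sno x t i.castSucc = x i := by simp [sno]

theorem ini_sno (x : Fin n → ℝ) (t : ℝ) : ini (sno x t) = x := by
  funext i; exact sno_cs x t i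

theorem sno_ini (z : Fin (n + 1) → ℝ) : sno (ini z) (z (Fin.last n)) = z := by
  funext i
  refine Fin.lastCases ?_ (fun i => ?_) i
  · exact sno_last _ _
  · exact sno_cs _ _ _

theorem ini_contDiff (p : ℕ) : ContDiff ℝ p (ini (n := n)) :=
  contDiff_pi.2 fun i => contDiff_apply ℝ ℝ i.castSucc

theorem sno_contDiffAt {E : Type} [NormedAddCommGroup E] [NormedSpace ℝ E] {p : ℕ} {f : E → Fin n → ℝ} {t : E → ℝ} {x : E}
    (hf : ContDiffAt ℝ p f x) (ht : ContDiffAt ℝ p t x) : ContDiffAt ℝ p (fun z => sno (f z) (t z)) x := by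
  rw [contDiffAt_pi]
  intro i
  refine Fin.lastCases ?_ (fun i => ?_) i
  · simpa only [sno_last] using ht
  · simpa only [sno_cs] using contDiffAt_pi.1 hf i

theorem DF.ini : DF L (ini (n := n)) := DF.pi fun i => DF.apply i.castSucc

theorem DF.sno {Γ : Type} [PseudoMetricSpace Γ] [DS Γ] {f : Γ → Fin n → ℝ} {t : Γ → ℝ}
    (hf : DF L f) (ht : DF L t) : DF L (fun z => sno (f z) (t z)) := by
  refine DF.pi fun i => ?_
  refine Fin.lastCases ?_ (fun i => ?_) i
  · simpa only [sno_last] using ht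
  · simpa only [sno_cs] using (DF.apply i).comp hf

theorem DF.extend {m : ℕ} {U : Set (Fin n → ℝ)} (hU : IsDef L U) {f : (Fin n → ℝ) → (Fin m → ℝ)} (hf : IsDefMapOn L U f) :
    ∃ f' : (Fin n → ℝ) → (Fin m → ℝ), DF L f' ∧ EqOn f' f U := by
  have hU' : DP L (fun x => x ∈ U) := hU
  have hf' : DP L (fun q : (Fin n → ℝ) × (Fin m → ℝ) => q.1 ∈ U ∧ q.2 = f q.1) := hf
  refine ⟨fun x => if x ∈ U then f x else 0, ?_, fun x hx => by simp [hx]⟩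
  refine DF.of_graph (R := fun x y => (x ∈ U ∧ y = f x) ∨ (x ∉ U ∧ y = 0)) ?_ ?_
  · exact hf'.or ((hU'.not.comp DF.fst).and (DP.eq (by fun_prop) (by fun_prop)))
  · intro z w
    by_cases h : z ∈ U <;> simp [h]

theorem DF.mapOn {m : ℕ} {U : Set (Fin n → ℝ)} (hU : DP L (fun x => x ∈ U)) {f : (Fin n → ℝ) → (Fin m → ℝ)} (hf : DF L f) :
    IsDefMapOn L U f := by
  have : DP L (fun q : (Fin n → ℝ) × (Fin m → ℝ) => q.1 ∈ U ∧ q.2 = f q.1) := (hU.comp DF.fst).and hf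
  exact this

theorem charts {p : ℕ} {M : Set (Fin n → ℝ)} (hM : IsDpSubmanifold L p d M) : ∀ x ∈ M,
    ∃ (U V : Set (Fin n → ℝ)) (φ ψ : (Fin n → ℝ) → (Fin n → ℝ)),
    IsOpen U ∧ x ∈ U ∧ IsOpen V ∧ (0 : Fin n → ℝ) ∈ V ∧
    DP L (fun x => x ∈ U) ∧ DP L (fun x => x ∈ V) ∧ DF L φ ∧ DF L ψ ∧
    ContDiffOn ℝ p φ U ∧ ContDiffOn ℝ p ψ V ∧
    Set.MapsTo φ U V ∧ Set.MapsTo ψ V U ∧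
    (∀ y ∈ U, ψ (φ y) = y) ∧ (∀ y ∈ V, φ (ψ y) = y) ∧
    φ x = 0 ∧ φ '' (M ∩ U) = V ∩ {y | ∀ i : Fin n, d ≤ (i : ℕ) → y i = 0} := by
  intro x hx
  obtain ⟨U, V, φ, ψ, h1, h2, h3, h4, h5, h6, h7, h8, h9, h10, h11, h12, h13, h14, h15, h16⟩ := hM.2.2 x hx
  obtain ⟨φ', a1, a2⟩ := DF.extend h5 h7
  obtain ⟨ψ', b1, b2⟩ := DF.extend h6 h8
  refine ⟨U, V, φ', ψ', h1, h2, h3, h4, h5, h6, a1, b1, h9.congr a2, h10.congr b2, h11.congr a2.symm, h12.congr b2.symm,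
    ?_, ?_, (a2 h2).trans h15, ?_⟩
  · intro y hy
    rw [a2 hy, b2 (h11 hy), h13 y hy]
  · intro y hy
    rw [b2 hy, a2 (h12 hy), h14 y hy]
  · rw [← h16]
    exact image_congr fun y hy => a2 hy.2

theorem sub_LC {p : ℕ} {M : Set (Fin n → ℝ)} (hM : IsDpSubmanifold L p d M) : LC M := by
  intro x hx
  obtain ⟨U, V, φ, ψ, h1, h2, h3, h4, h5, h6, h7, h8, h9, h10, h11, h12, h13, h14, h15, h16⟩ := charts hM x hx
  filter_upwards [h1.mem_nhds h2] with x' hx' hfr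
  apply hfr.2
  have hc : ContinuousAt φ x' := h9.continuousOn.continuousAt (h1.mem_nhds hx')
  have hflat : φ x' ∈ V ∩ {y | ∀ i : Fin n, d ≤ (i : ℕ) → y i = 0} := by
    refine ⟨h11 hx', fun i hi => ?_⟩
    by_contra hne
    have hci : ContinuousAt (fun y => φ y i) x' := (continuous_apply i).continuousAt.comp hc
    have hev := hci.eventually_ne hne
    obtain ⟨m, hm, hm1, hm2⟩ := ((mem_closure_iff_frequently.1 hfr.1).and_eventually (hev.and (h1.mem_nhds hx'))).exists
    have : φ m ∈ φ '' (M ∩ U) := ⟨m, ⟨hm, hm2⟩, rfl⟩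
    rw [h16] at this
    exact hm1 (this.2 i hi)
  rw [← h16] at hflat
  obtain ⟨m, hm, hme⟩ := hflat
  have : m = x' := by rw [← h13 m hm.2, hme, h13 x' hx']
  exact this ▸ hm.1

theorem exists_g (hL : DMinimal L) {p : ℕ} {M : Set (Fin n → ℝ)} (hM : IsDpSubmanifold L p d M) :
    ∃ g : (Fin n → ℝ) → ℝ, DF L g ∧ ∀ b ∈ M, ContDiffAt ℝ p g b ∧ ∀ x ∈ fr M, 1 ≤ g b * dist x b := by
  have hMd : DP L (fun x => x ∈ M) := hM.1
  have hlc := sub_LC hM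
  obtain ⟨k, hk, hk1, hk2⟩ := recip (L := L) (S := M) (bad := fun b x => x ∈ fr M) (hMd.fr.comp DF.snd) (by
      intro b hb
      obtain ⟨r1, hr1, h1⟩ := Metric.eventually_nhds_iff.1 (hlc b hb)
      refine ⟨r1/2, by positivity, ?_⟩
      filter_upwards [Metric.ball_mem_nhds b (half_pos hr1)] with b' a2 hb' x hx
      rw [Metric.mem_ball] at a2
      have htri := dist_triangle x b' b
      by_contra hlt
      exact h1 (show dist x b < r1 by linarith) hx)
  obtain ⟨g, hg, hg1⟩ := (dom_cut hL p M hMd hlc).1 k hk hk2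
  refine ⟨g, hg, fun b hb => ⟨(hg1 b hb).1, fun x hx => ((hk1 b hb).2 x hx).trans ?_⟩⟩
  have := (hg1 b hb).2
  gcongr

/-- the graph of `g` over `M` -/
def gra (M : Set (Fin n → ℝ)) (g : (Fin n → ℝ) → ℝ) : Set (Fin (n + 1) → ℝ) :=
  {z | ini z ∈ M ∧ z (Fin.last n) = g (ini z)}

theorem gra_closed {M : Set (Fin n → ℝ)} {g : (Fin n → ℝ) → ℝ} (hc : ∀ b ∈ M, ContinuousAt g b)
    (hg : ∀ b ∈ M, ∀ x ∈ fr M, 1 ≤ g b * dist x b) : IsClosed (gra M g) := by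
  have hic : Continuous (ini (n := n)) := (ini_contDiff 0).continuous
  refine isClosed_of_closure_subset fun z hz => ?_
  have hx : ini z ∈ closure M := by
    have := image_closure_subset_closure_image hic (mem_image_of_mem ini hz)
    refine closure_mono ?_ this
    rintro _ ⟨w, hw, rfl⟩
    exact hw.1
  have hxM : ini z ∈ M := by
    by_contra hn
    have hcl : IsClosed {w : Fin (n + 1) → ℝ | 1 ≤ w (Fin.last n) * dist (ini z) (ini w)} :=
      isClosed_le continuous_const (by fun_prop)
    have hsub : gra M g ⊆ {w : Fin (n + 1) → ℝ | 1 ≤ w (Fin.last n) * dist (ini z) (ini w)} := by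
      intro w hw
      change 1 ≤ w (Fin.last n) * dist (ini z) (ini w)
      rw [hw.2]
      exact hg _ hw.1 _ ⟨hx, hn⟩
    have h1 : 1 ≤ z (Fin.last n) * dist (ini z) (ini z) := closure_minimal hsub hcl hz
    rw [dist_self, mul_zero] at h1
    linarith
  refine ⟨hxM, ?_⟩
  by_contra hne
  have c1 : ContinuousAt (fun w : Fin (n + 1) → ℝ => w (Fin.last n) - g (ini w)) z := by
    refine (continuous_apply _).continuousAt.sub ?_
    exact ContinuousAt.comp (g := g) (f := ini) (hc _ hxM) hic.continuousAt
  have hev := c1.eventually_ne (sub_ne_zero.2 hne)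
  obtain ⟨w, hw, hw1⟩ := ((mem_closure_iff_frequently.1 hz).and_eventually hev).exists
  exact hw1 (sub_eq_zero.2 hw.2)

theorem gra_sub {p : ℕ} {M : Set (Fin n → ℝ)} (hM : IsDpSubmanifold L p d M) {g : (Fin n → ℝ) → ℝ} (hg : DF L g)
    (hc : ∀ b ∈ M, ContDiffAt ℝ p g b) : IsDpSubmanifold L p d (gra M g) := by
  have hMd : DP L (fun x => x ∈ M) := hM.1
  have hini : DF L (ini (n := n)) := DF.ini
  have hgr : DP L (fun z => z ∈ gra M g) := (hMd.comp hini).and (DP.eq (by fun_prop) (by fun_prop))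
  refine ⟨hgr, hM.2.1.trans (Nat.le_succ n), ?_⟩
  intro z hz
  obtain ⟨U, V, φ, ψ, h1, h2, h3, h4, h5, h6, h7, h8, h9, h10, h11, h12, h13, h14, h15, h16⟩ := charts hM _ hz.1
  let W : Set (Fin n → ℝ) := {x | ContDiffAt ℝ p g x}
  have hW : IsOpen W := by
    rw [isOpen_iff_mem_nhds]
    intro x hx
    exact cd_ev hx
  have hWd : DP L (fun x => x ∈ W) := DP.contDiffAt' p hg
  have hic : Continuous (ini (n := n)) := (ini_contDiff 0).continuous
  let U' : Set (Fin (n + 1) → ℝ) := {w | ini w ∈ U ∧ ini w ∈ W}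
  let V' : Set (Fin (n + 1) → ℝ) := {w | ini w ∈ V ∧ ψ (ini w) ∈ W}
  let Φ : (Fin (n + 1) → ℝ) → (Fin (n + 1) → ℝ) := fun w => sno (φ (ini w)) (w (Fin.last n) - g (ini w))
  let Ψ : (Fin (n + 1) → ℝ) → (Fin (n + 1) → ℝ) := fun w => sno (ψ (ini w)) (w (Fin.last n) + g (ψ (ini w)))
  have iΦ : ∀ w, ini (Φ w) = φ (ini w) := fun w => ini_sno _ _
  have iΨ : ∀ w, ini (Ψ w) = ψ (ini w) := fun w => ini_sno _ _
  have lΦ : ∀ w, Φ w (Fin.last n) = w (Fin.last n) - g (ini w) := fun w => sno_last _ _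
  have lΨ : ∀ w, Ψ w (Fin.last n) = w (Fin.last n) + g (ψ (ini w)) := fun w => sno_last _ _
  have hU'o : IsOpen U' := (h1.inter hW).preimage hic
  have hV'o : IsOpen V' := (h10.continuousOn.isOpen_inter_preimage h3 hW).preimage hic
  have hzφ : φ (ini z) = 0 := h15
  have hψ0 : ψ 0 = ini z := by rw [← hzφ, h13 _ h2]
  have i0 : ini (0 : Fin (n + 1) → ℝ) = 0 := rfl
  have hU'd : DP L (fun w => w ∈ U') := (h5.comp hini).and (hWd.comp hini)
  have hψi : DF L (fun w : Fin (n + 1) → ℝ => ψ (ini w)) := h8.comp hini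
  have hφi : DF L (fun w : Fin (n + 1) → ℝ => φ (ini w)) := h7.comp hini
  have hV'd : DP L (fun w => w ∈ V') := (h6.comp hini).and (hWd.comp hψi)
  have hΦd : DF L Φ := DF.sno hφi ((DF.apply _).sub (hg.comp hini))
  have hΨd : DF L Ψ := DF.sno hψi ((DF.apply _).add (hg.comp hψi))
  have mΦ : MapsTo Φ U' V' := by
    intro w hw
    change ini (Φ w) ∈ V ∧ ψ (ini (Φ w)) ∈ W
    rw [iΦ, h13 _ hw.1]
    exact ⟨h11 hw.1, hw.2⟩
  have mΨ : MapsTo Ψ V' U' := by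
    intro w hw
    change ini (Ψ w) ∈ U ∧ ini (Ψ w) ∈ W
    rw [iΨ]
    exact ⟨h12 hw.1, hw.2⟩
  have rΦ : ∀ w ∈ V', Φ (Ψ w) = w := by
    intro w hw
    rw [← sno_ini (Φ (Ψ w)), iΦ, lΦ, iΨ, lΨ, h14 _ hw.1, add_sub_cancel_right, sno_ini]
  have lΦΨ : ∀ w ∈ U', Ψ (Φ w) = w := by
    intro w hw
    rw [← sno_ini (Ψ (Φ w)), iΨ, lΨ, iΦ, lΦ, h13 _ hw.1, sub_add_cancel, sno_ini]
  have hlastc : ContDiff ℝ p (fun w : Fin (n + 1) → ℝ => w (Fin.last n)) := contDiff_apply ℝ ℝ _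
  refine ⟨U', V', Φ, Ψ, hU'o, ⟨h2, hc _ hz.1⟩, hV'o, ?_, hU'd, hV'd, DF.mapOn hU'd hΦd, DF.mapOn hV'd hΨd, ?_, ?_,
    mΦ, mΨ, lΦΨ, rΦ, ?_, ?_⟩
  · change ini 0 ∈ V ∧ ψ (ini 0) ∈ W
    rw [i0, hψ0]
    exact ⟨h4, hc _ hz.1⟩
  · intro w hw
    refine ContDiffAt.contDiffWithinAt (sno_contDiffAt ?_ ?_)
    · exact ContDiffAt.comp (g := φ) (f := ini) w (h9.contDiffAt (h1.mem_nhds hw.1)) (ini_contDiff p).contDiffAt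
    · exact hlastc.contDiffAt.sub (ContDiffAt.comp (g := g) (f := ini) w hw.2 (ini_contDiff p).contDiffAt)
  · intro w hw
    have c1 : ContDiffAt ℝ p (fun w => ψ (ini w)) w :=
      ContDiffAt.comp (g := ψ) (f := ini) w (h10.contDiffAt (h3.mem_nhds hw.1)) (ini_contDiff p).contDiffAt
    refine ContDiffAt.contDiffWithinAt (sno_contDiffAt c1 ?_)
    exact hlastc.contDiffAt.add (ContDiffAt.comp (g := g) (f := fun w => ψ (ini w)) w hw.2 c1)
  · rw [← sno_ini (Φ z), iΦ, lΦ, hzφ, hz.2, sub_self]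
    exact sno_ini (0 : Fin (n + 1) → ℝ)
  · ext w
    constructor
    · rintro ⟨y, ⟨hy1, hy2⟩, rfl⟩
      refine ⟨mΦ hy2, fun i => ?_⟩
      refine Fin.lastCases ?_ (fun i => ?_) i
      · intro _
        rw [lΦ, hy1.2, sub_self]
      · intro hi
        have : φ (ini y) ∈ φ '' (M ∩ U) := ⟨_, ⟨hy1.1, hy2.1⟩, rfl⟩
        rw [h16] at this
        change ini (Φ y) i = 0
        rw [iΦ]
        exact this.2 i hi
    · rintro ⟨hw1, hw2⟩
      refine ⟨Ψ w, ⟨⟨?_, ?_⟩, mΨ hw1⟩, rΦ w hw1⟩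
      · have : ini w ∈ φ '' (M ∩ U) := by
          rw [h16]
          exact ⟨hw1.1, fun i hi => hw2 i.castSucc hi⟩
        obtain ⟨m, hm, hme⟩ := this
        rw [iΨ, ← hme, h13 _ hm.2]
        exact hm.1
      · rw [lΨ, iΨ, hw2 (Fin.last n) (by simpa using hM.2.1), zero_add]
end final

/-- every `D^p` submanifold of `ℝⁿ` is definably `C^p` diffeomorphic to a
closed `D^p` submanifold of `ℝ^{n+1}`. -/
theorem stmt6 (L : FirstOrder.Language) [L.Structure ℝ] (hL : DMinimal L) (p n d : ℕ)
    (M : Set (Fin n → ℝ)) (hM : IsDpSubmanifold L p d M) :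
    ∃ M' : Set (Fin (n + 1) → ℝ), IsClosed M' ∧ IsDpSubmanifold L p d M' ∧
      ∃ (F : (Fin n → ℝ) → (Fin (n + 1) → ℝ)) (G : (Fin (n + 1) → ℝ) → (Fin n → ℝ)),
        IsDefMapOn L M F ∧ IsDefMapOn L M' G ∧ CpOn p F M ∧ CpOn p G M' ∧
        Set.MapsTo F M M' ∧ Set.MapsTo G M' M ∧
        (∀ x ∈ M, G (F x) = x) ∧ (∀ y ∈ M', F (G y) = y) := by
  have : Fact (ExpandsOrderedField L) := ⟨hL.1⟩
  obtain ⟨g, hg, hg1⟩ := exists_g hL hM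
  have hc : ∀ b ∈ M, ContDiffAt ℝ p g b := fun b hb => (hg1 b hb).1
  have hsub := gra_sub hM hg hc
  refine ⟨gra M g, gra_closed (fun b hb => (hc b hb).continuousAt) (fun b hb => (hg1 b hb).2), hsub,
    fun x => sno x (g x), ini, DF.mapOn (U := M) hM.1 (DF.sno DF.id hg), DF.mapOn (U := gra M g) hsub.1 DF.ini, ?_, ?_, ?_, ?_, ?_, ?_⟩
  · intro x hx
    refine ⟨{x | ContDiffAt ℝ p g x}, fun x => sno x (g x), ?_, hc x hx, ?_, fun _ _ => rfl⟩
    · rw [isOpen_iff_mem_nhds]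
      intro x hx
      exact cd_ev hx
    · intro y hy
      exact ContDiffAt.contDiffWithinAt (sno_contDiffAt contDiffAt_id hy)
  · intro z _
    exact ⟨univ, ini, isOpen_univ, mem_univ z, (ini_contDiff p).contDiffOn, fun _ _ => rfl⟩
  · intro x hx
    refine ⟨?_, ?_⟩
    · rw [ini_sno]; exact hx
    · rw [ini_sno]; exact sno_last _ _
  · intro z hz
    exact hz.1
  · intro x _
    exact ini_sno _ _
  · intro z hz
    change sno (ini z) (g (ini z)) = z
    rw [← hz.2, sno_ini]

end DMinPaper
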